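/- For positive integers d_A ≤ d_{Ā}, the average entanglement entropy of a Haar-random pure state on ℂ^{d_A} ⊗ ℂ^{d_Ā} equals Σ_{k=d_Ā+1}^{d_A d_Ā} 1/k − (d_A − 1)/(2 d_Ā). -/

import Mathlib

open Matrix BigOperators MeasureTheory

/-- The reduced density matrix of a pure state `ψ` on `ℂ^{d_A} ⊗ ℂ^{d_Ā}`,
obtained by the partial trace over the second factor. -/
noncomputable def reducedDM {dA dB : ℕ} (ψ : Fin dA × Fin dB → ℂ) :
    Matrix (Fin dA) (Fin dA) ℂ :=
  fun k k' => ∑ l : Fin dB, ψ (k, l) * (starRingEnd ℂ) (ψ (k', l))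

/-- The von Neumann entropy `-Tr(ρ ln ρ)` of a Hermitian matrix, via its eigenvalues
(junk value `0` if the matrix is not Hermitian). -/
noncomputable def vnEntropy {n : ℕ} (ρ : Matrix (Fin n) (Fin n) ℂ) : ℝ :=
  if h : ρ.IsHermitian then ∑ i, Real.negMulLog (h.eigenvalues i) else 0


section PageGauss
open scoped Real

/-- finite moments -/
def PgMom {E : Type*} [NormedAddCommGroup E] [MeasurableSpace E] (μ : Measure E) : Prop :=
  ∀ N : ℕ, Integrable (fun x => (1 + ‖x‖) ^ N) μ

/-- continuous functions of polynomial growth -/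
def PgPG (E : Type*) [NormedAddCommGroup E] : Subalgebra ℂ (E → ℂ) where
  carrier := {f | Continuous f ∧ ∃ (C : ℝ) (N : ℕ), ∀ x, ‖f x‖ ≤ C * (1 + ‖x‖) ^ N}
  mul_mem' := by
    rintro f g ⟨hf, C, N, h⟩ ⟨hg, C', N', h'⟩
    refine ⟨hf.mul hg, C * C', N + N', fun x => ?_⟩
    rw [Pi.mul_apply, norm_mul]
    calc _ ≤ (C * (1 + ‖x‖) ^ N) * (C' * (1 + ‖x‖) ^ N') :=
          mul_le_mul (h x) (h' x) (norm_nonneg _) ((norm_nonneg _).trans (h x))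
      _ = _ := by ring
  add_mem' := by
    rintro f g ⟨hf, C, N, h⟩ ⟨hg, C', N', h'⟩
    refine ⟨hf.add hg, |C| + |C'|, N + N', fun x => ?_⟩
    have h1 : (1 : ℝ) ≤ 1 + ‖x‖ := by linarith [norm_nonneg x]
    have e1 : (1 + ‖x‖) ^ N ≤ (1 + ‖x‖) ^ (N + N') := pow_le_pow_right₀ h1 (by omega)
    have e2 : (1 + ‖x‖) ^ N' ≤ (1 + ‖x‖) ^ (N + N') := pow_le_pow_right₀ h1 (by omega)
    have p1 : 0 ≤ (1 + ‖x‖) ^ N := by positivity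
    have p2 : 0 ≤ (1 + ‖x‖) ^ N' := by positivity
    calc ‖f x + g x‖ ≤ ‖f x‖ + ‖g x‖ := norm_add_le _ _
      _ ≤ C * (1 + ‖x‖) ^ N + C' * (1 + ‖x‖) ^ N' := add_le_add (h x) (h' x)
      _ ≤ |C| * (1 + ‖x‖) ^ N + |C'| * (1 + ‖x‖) ^ N' :=
          add_le_add (mul_le_mul_of_nonneg_right (le_abs_self _) p1)
            (mul_le_mul_of_nonneg_right (le_abs_self _) p2)
      _ ≤ |C| * (1 + ‖x‖) ^ (N + N') + |C'| * (1 + ‖x‖) ^ (N + N') := by gcongr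
      _ = _ := by ring
  algebraMap_mem' := by
    intro r
    exact ⟨continuous_const, ‖r‖, 0, fun x => by simp⟩

lemma pgPG_cont {E : Type*} [NormedAddCommGroup E] {f : E → ℂ} (hf : f ∈ PgPG E) :
    Continuous f := hf.1

lemma pgPG_comp {E F : Type*} [NormedAddCommGroup E] [NormedSpace ℝ E] [NormedAddCommGroup F]
    [NormedSpace ℝ F] (L : E →L[ℝ] F) {f : F → ℂ} (hf : f ∈ PgPG F) : (fun x => f (L x)) ∈ PgPG E := by
  obtain ⟨hc, C, N, h⟩ := hf
  refine ⟨hc.comp L.continuous, |C| * (1 + ‖L‖) ^ N, N, fun x => ?_⟩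
  calc _ ≤ C * (1 + ‖L x‖) ^ N := h _
    _ ≤ |C| * (1 + ‖L x‖) ^ N := by gcongr; exact le_abs_self _
    _ ≤ |C| * ((1 + ‖L‖) * (1 + ‖x‖)) ^ N := by
        gcongr
        have := L.le_opNorm x
        nlinarith [norm_nonneg L, norm_nonneg x]
    _ = _ := by rw [mul_pow]; ring

lemma pgPG_clm {E : Type*} [NormedAddCommGroup E] [NormedSpace ℝ E] (L : E →L[ℝ] ℂ) :
    (fun x => L x) ∈ PgPG E := by
  refine ⟨L.continuous, ‖L‖, 1, fun x => ?_⟩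
  have := L.le_opNorm x
  nlinarith [norm_nonneg L, norm_nonneg x]

lemma pgPG_star {E : Type*} [NormedAddCommGroup E] {f : E → ℂ} (hf : f ∈ PgPG E) :
    (fun x => star (f x)) ∈ PgPG E := by
  obtain ⟨hc, C, N, h⟩ := hf
  exact ⟨hc.star, C, N, fun x => by simpa using h x⟩

lemma pgPG_int {E : Type*} [NormedAddCommGroup E] [MeasurableSpace E] [BorelSpace E]
    [SecondCountableTopology E]
    {μ : Measure E} (hμ : PgMom μ) {f : E → ℂ} (hf : f ∈ PgPG E) : Integrable f μ := by
  obtain ⟨hc, C, N, h⟩ := hf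
  exact ((hμ N).const_mul C).mono' hc.aestronglyMeasurable (Filter.Eventually.of_forall h)

lemma pgMom_prod {E F : Type*} [NormedAddCommGroup E] [MeasurableSpace E] [BorelSpace E]
    [SecondCountableTopology E] [NormedAddCommGroup F] [MeasurableSpace F] [BorelSpace F]
    [SecondCountableTopology F]
    {μ : Measure E} {ν : Measure F} [SFinite μ] [SFinite ν] (hμ : PgMom μ) (hν : PgMom ν) :
    PgMom (μ.prod ν) := by
  intro N
  refine ((hμ N).mul_prod (hν N)).mono' ?_ (Filter.Eventually.of_forall fun x => ?_)
  · exact (by fun_prop : Continuous fun x : E × F => (1 + ‖x‖) ^ N).aestronglyMeasurable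
  · rw [Real.norm_of_nonneg (by positivity), ← mul_pow]
    gcongr
    rw [Prod.norm_def]
    have := norm_nonneg x.1
    have := norm_nonneg x.2
    rcases max_cases ‖x.1‖ ‖x.2‖ with ⟨h, _⟩ | ⟨h, _⟩ <;> rw [h] <;> nlinarith

lemma pgMom_pi {ι E : Type*} [Fintype ι] [NormedAddCommGroup E] [MeasurableSpace E] [BorelSpace E]
    [SecondCountableTopology E]
    {μ : Measure E} [SigmaFinite μ] (hμ : PgMom μ) :
    PgMom (Measure.pi (fun _ : ι => μ)) := by
  intro N
  have := Integrable.fintype_prod (ι := ι) (μ := fun _ => μ) (f := fun _ x => (1 + ‖x‖) ^ N)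
    (fun _ => hμ N)
  refine this.mono' ?_ (Filter.Eventually.of_forall fun x => ?_)
  · exact (by fun_prop : Continuous fun x : ι → E => (1 + ‖x‖) ^ N).aestronglyMeasurable
  · rw [Real.norm_of_nonneg (by positivity), Finset.prod_pow]
    gcongr
    have hs : ∀ s : Finset ι, 1 ≤ ∏ i ∈ s, (1 + ‖x i‖) := fun s =>
      Finset.prod_induction _ (fun y => (1 : ℝ) ≤ y) (fun a b ha hb => one_le_mul_of_one_le_of_one_le ha hb)
        le_rfl (fun i _ => by simp)
    have h1 : ∀ i, 1 + ‖x i‖ ≤ ∏ i, (1 + ‖x i‖) := fun i => by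
      classical
      rw [← Finset.mul_prod_erase _ _ (Finset.mem_univ i)]
      exact le_mul_of_one_le_right (by positivity) (hs _)
    have h0 : 1 ≤ ∏ i, (1 + ‖x i‖) := hs _
    have : ‖x‖ ≤ ∏ i, (1 + ‖x i‖) - 1 :=
      (pi_norm_le_iff_of_nonneg (by linarith)).2 fun i => by linarith [h1 i]
    linarith

/-- standard complex Gaussian -/
noncomputable def pgGam : Measure ℂ :=
  volume.withDensity (fun z => ENNReal.ofReal (π⁻¹ * Real.exp (-‖z‖ ^ 2)))

lemma pgGam_integral {F : Type*} [NormedAddCommGroup F] [NormedSpace ℝ F] (f : ℂ → F) :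
    ∫ z, f z ∂pgGam = ∫ z, (π⁻¹ * Real.exp (-‖z‖ ^ 2)) • f z := by
  rw [pgGam, integral_withDensity_eq_integral_toReal_smul (by fun_prop) (by simp)]
  congr 1; ext z
  rw [ENNReal.toReal_ofReal (by positivity)]

lemma pgGam_int0 (k : ℕ) : ∫ z : ℂ, ‖z‖ ^ k * Real.exp (-‖z‖ ^ 2) = π * Real.Gamma ((k + 2) / 2) := by
  have := Complex.integral_rpow_mul_exp_neg_rpow (p := 2) (q := k) (by norm_num)
    (by have : (0:ℝ) ≤ k := by positivity
        linarith)
  simp only [Real.rpow_natCast, Real.rpow_ofNat] at this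
  rw [this]; ring

lemma pgGam_integrable0 (k : ℕ) : Integrable (fun z : ℂ => ‖z‖ ^ k * Real.exp (-‖z‖ ^ 2)) := by
  by_contra h
  have := integral_undef h
  rw [pgGam_int0] at this
  have h2 := Real.Gamma_pos_of_pos (s := ((k:ℝ) + 2) / 2) (by positivity)
  have := mul_pos Real.pi_pos h2
  linarith

lemma pgGam_moment (a : ℕ) : ∫ z, ‖z‖ ^ (2 * a) ∂pgGam = (a.factorial : ℝ) := by
  rw [pgGam_integral]
  have : ∀ z : ℂ, (π⁻¹ * Real.exp (-‖z‖ ^ 2)) • ‖z‖ ^ (2 * a)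
      = π⁻¹ * (‖z‖ ^ (2 * a) * Real.exp (-‖z‖ ^ 2)) := fun z => by
    rw [smul_eq_mul]; ring
  simp_rw [this]
  rw [integral_const_mul, pgGam_int0, ← Real.Gamma_nat_eq_factorial, ← mul_assoc,
    inv_mul_cancel₀ Real.pi_ne_zero, one_mul]
  congr 1; push_cast; ring

instance pgGam_prob : IsProbabilityMeasure pgGam := by
  constructor
  rw [pgGam, withDensity_apply _ MeasurableSet.univ, Measure.restrict_univ,
    ← ofReal_integral_eq_lintegral_ofReal]
  · rw [integral_const_mul]
    have := pgGam_int0 0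
    simp only [pow_zero, one_mul] at this
    rw [this]; simp
  · exact ((pgGam_integrable0 0).const_mul π⁻¹).congr (Filter.Eventually.of_forall fun z => by simp)
  · exact Filter.Eventually.of_forall fun z => by positivity

lemma pgGam_mom : PgMom pgGam := by
  have h : ∀ k : ℕ, Integrable (fun z : ℂ => ‖z‖ ^ k) pgGam := by
    intro k
    rw [pgGam, integrable_withDensity_iff (by fun_prop) (by simp)]
    refine ((pgGam_integrable0 k).const_mul π⁻¹).congr (Filter.Eventually.of_forall fun z => ?_)
    dsimp only
    rw [ENNReal.toReal_ofReal (by positivity)]; ring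
  intro N
  simp_rw [add_comm (1:ℝ), add_pow]
  exact integrable_finsetSum _ fun i _ => ((h i).mul_const _).mul_const _

lemma pgGam_charFun (t : ℂ) :
    ∫ z, Complex.exp (inner ℝ z t * Complex.I) ∂pgGam = Complex.exp (-(‖t‖ ^ 2 / 4 : ℝ)) := by
  rw [pgGam_integral]
  have h := GaussianFourier.integral_cexp_neg_mul_sq_norm_add (V := ℂ) (b := 1) (by simp) Complex.I t
  have : ∀ z : ℂ, (π⁻¹ * Real.exp (-‖z‖ ^ 2)) • Complex.exp (inner ℝ z t * Complex.I)
      = (π⁻¹ : ℂ) * Complex.exp (-1 * ‖z‖ ^ 2 + Complex.I * inner ℝ t z) := by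
    intro z
    rw [Complex.exp_add, Complex.real_smul, real_inner_comm]; push_cast
    ring_nf
  simp_rw [this]
  rw [integral_const_mul, h]
  have hpi : (π : ℂ) ≠ 0 := by exact_mod_cast Real.pi_ne_zero
  simp [hpi]
  ring_nf

/-- Gaussian on a finite power -/
noncomputable def pgG (ι : Type*) [Fintype ι] : Measure (ι → ℂ) := Measure.pi (fun _ => pgGam)

instance pgG_prob (ι : Type*) [Fintype ι] : IsProbabilityMeasure (pgG ι) := by
  unfold pgG; infer_instance

lemma pgG_mom (ι : Type*) [Fintype ι] : PgMom (pgG ι) := pgMom_pi pgGam_mom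

end PageGauss


section PageInv
open scoped Real
variable {ι : Type*} [Fintype ι]

/-- squared norm -/
noncomputable def pgN (x : ι → ℂ) : ℝ := ∑ i, Complex.normSq (x i)

/-- real inner product -/
noncomputable def pgB (x y : ι → ℂ) : ℝ := (star x ⬝ᵥ y).re

lemma pgN_nonneg (x : ι → ℂ) : 0 ≤ pgN x := Finset.sum_nonneg fun _ _ => Complex.normSq_nonneg _

lemma pgN_cont : Continuous (pgN : (ι → ℂ) → ℝ) := by
  unfold pgN
  exact continuous_finsetSum _ fun i _ => Complex.continuous_normSq.comp (continuous_apply i)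

lemma pgN_smul (c : ℝ) (x : ι → ℂ) : pgN (c • x) = c ^ 2 * pgN x := by
  simp [pgN, Finset.mul_sum, pow_two]

lemma pgN_dot (x : ι → ℂ) : star x ⬝ᵥ x = (pgN x : ℂ) := by
  simp only [dotProduct, pgN, Pi.star_apply, RCLike.star_def, Complex.ofReal_sum]
  exact Finset.sum_congr rfl fun i _ => by rw [Complex.normSq_eq_conj_mul_self]

lemma pgN_eq_zero {x : ι → ℂ} (h : pgN x = 0) : x = 0 := by
  funext i
  have := (Finset.sum_eq_zero_iff_of_nonneg (fun i _ => Complex.normSq_nonneg (x i))).1 h i (Finset.mem_univ i)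
  exact Complex.normSq_eq_zero.1 this

lemma pgN_B (x : ι → ℂ) : pgB x x = pgN x := by
  rw [pgB, pgN_dot, Complex.ofReal_re]

lemma pgB_sum (x y : ι → ℂ) : pgB x y = ∑ i, inner ℝ (x i) (y i) := by
  simp [pgB, dotProduct, Complex.inner]
  exact Finset.sum_congr rfl fun i _ => by ring

lemma pgB_comm (x y : ι → ℂ) : pgB x y = pgB y x := by
  simp_rw [pgB_sum, real_inner_comm]

lemma pgB_smul_left (c : ℝ) (x y : ι → ℂ) : pgB (c • x) y = c * pgB x y := by
  simp_rw [pgB_sum, Finset.mul_sum, Pi.smul_apply, real_inner_smul_left]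

lemma pgB_smul_right (c : ℝ) (x y : ι → ℂ) : pgB x (c • y) = c * pgB x y := by
  rw [pgB_comm, pgB_smul_left, pgB_comm]

lemma pgB_cont : Continuous (fun p : (ι → ℂ) × (ι → ℂ) => pgB p.1 p.2) := by
  simp_rw [pgB_sum]; fun_prop

lemma pgB_mulVec (U : Matrix ι ι ℂ) (x y : ι → ℂ) : pgB (U *ᵥ x) y = pgB x (Uᴴ *ᵥ y) := by
  rw [pgB, pgB, star_mulVec, dotProduct_mulVec]

/-- bilinear form -/
noncomputable def pgL (ι : Type*) [Fintype ι] : (ι → ℂ) →ₗ[ℝ] (ι → ℂ) →ₗ[ℝ] ℝ :=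
  LinearMap.mk₂ ℝ pgB
    (fun x y z => by simp [pgB_sum, inner_add_left, Finset.sum_add_distrib])
    (fun c x y => pgB_smul_left c x y)
    (fun x y z => by simp [pgB_sum, inner_add_right, Finset.sum_add_distrib])
    (fun c x y => pgB_smul_right c x y)

lemma pg_ext {P P' : Measure (ι → ℂ)} [IsFiniteMeasure P] [IsFiniteMeasure P']
    (h : ∀ w, ∫ v, Complex.exp (pgB v w * Complex.I) ∂P = ∫ v, Complex.exp (pgB v w * Complex.I) ∂P') :
    P = P' := by
  refine ext_of_integral_char_eq (L := pgL ι) Real.continuous_probChar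
    Real.probChar_ne_one ?_ pgB_cont ?_
  · intro v hv h0
    have : pgL ι v v = 0 := by rw [h0]; rfl
    exact hv (pgN_eq_zero ((pgN_B v).symm.trans this))
  · exact h

/-- unitary invariance -/
def PgInv [DecidableEq ι] (μ : Measure (ι → ℂ)) : Prop :=
  ∀ U ∈ Matrix.unitaryGroup ι ℂ, μ.map (fun ψ => U.mulVec ψ) = μ

lemma pg_mulVec_cont (U : Matrix ι ι ℂ) : Continuous (fun ψ => U.mulVec ψ) := by fun_prop

lemma pg_unit_N [DecidableEq ι] {U : Matrix ι ι ℂ} (hU : U ∈ unitaryGroup ι ℂ) (x : ι → ℂ) :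
    pgN (U *ᵥ x) = pgN x := by
  rw [← pgN_B, pgB_mulVec, mulVec_mulVec, ← star_eq_conjTranspose, (mem_unitaryGroup_iff').1 hU, one_mulVec,
    pgN_B]

lemma pgG_char (w : ι → ℂ) :
    ∫ v, Complex.exp (pgB v w * Complex.I) ∂(pgG ι) = Complex.exp (-(pgN w / 4 : ℝ)) := by
  simp_rw [pgB_sum, Complex.ofReal_sum, Finset.sum_mul, Complex.exp_sum]
  rw [pgG, integral_fintype_prod_eq_prod (f := fun i (z : ℂ) => Complex.exp (inner ℝ z (w i) * Complex.I))]
  simp_rw [pgGam_charFun]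
  rw [← Complex.exp_sum]
  congr 1
  rw [pgN, Finset.sum_div, Complex.ofReal_sum, Finset.sum_neg_distrib]
  simp [Complex.normSq_eq_norm_sq]

lemma pgG_inv [DecidableEq ι] : PgInv (pgG ι) := by
  intro U hU
  have : IsProbabilityMeasure ((pgG ι).map (fun ψ => U.mulVec ψ)) :=
    Measure.isProbabilityMeasure_map (pg_mulVec_cont U).aemeasurable
  refine pg_ext fun w => ?_
  rw [integral_map (pg_mulVec_cont U).aemeasurable]
  · simp_rw [pgB_mulVec, pgG_char]
    rw [← star_eq_conjTranspose, pg_unit_N (Unitary.star_mem hU)]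
  · refine Continuous.aestronglyMeasurable ?_
    have : Continuous (fun v => pgB v w) := pgB_cont.comp (by fun_prop : Continuous fun v => (v, w))
    fun_prop

lemma PgInv.integral [DecidableEq ι] {μ : Measure (ι → ℂ)} (hμ : PgInv μ) {U : Matrix ι ι ℂ}
    (hU : U ∈ unitaryGroup ι ℂ) {f : (ι → ℂ) → ℂ} (hf : Continuous f) :
    ∫ x, f (U *ᵥ x) ∂μ = ∫ x, f x ∂μ := by
  conv_rhs => rw [← hμ U hU]
  rw [integral_map (pg_mulVec_cont U).aemeasurable hf.aestronglyMeasurable]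

lemma pg_trans0 [DecidableEq ι] (i0 : ι) (x : ι → ℂ) :
    ∃ U ∈ unitaryGroup ι ℂ, U *ᵥ (Pi.single i0 (Real.sqrt (pgN x) : ℂ)) = x := by
  by_cases hx : pgN x = 0
  · refine ⟨1, one_mem _, ?_⟩
    rw [hx, pgN_eq_zero hx]; simp
  have hpos : 0 < Real.sqrt (pgN x) := Real.sqrt_pos.2 (lt_of_le_of_ne (pgN_nonneg x) (Ne.symm hx))
  set r := Real.sqrt (pgN x) with hr
  have hnorm : ‖(WithLp.toLp 2 x : EuclideanSpace ℂ ι)‖ = r := by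
    rw [EuclideanSpace.norm_eq, hr, pgN]
    simp [Complex.normSq_eq_norm_sq]
  have hon : Orthonormal ℂ (({i0} : Set ι).domRestrict
      (fun _ : ι => ((r⁻¹ : ℝ) : ℂ) • (WithLp.toLp 2 x : EuclideanSpace ℂ ι))) := by
    constructor
    · intro i
      rw [Set.domRestrict_apply, norm_smul, hnorm, Complex.norm_real, Real.norm_of_nonneg (by positivity)]
      exact inv_mul_cancel₀ hpos.ne'
    · intro i j hij
      exact absurd (Subsingleton.elim i j) hij
  obtain ⟨b, hb⟩ := hon.exists_orthonormalBasis_extension_of_card_eq (by simp)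
  refine ⟨(EuclideanSpace.basisFun ι ℂ).toBasis.toMatrix b,
    (EuclideanSpace.basisFun ι ℂ).toMatrix_orthonormalBasis_mem_unitary b, ?_⟩
  funext i
  rw [mulVec_single]
  have h1 := hb i0 (Set.mem_singleton _)
  simp only [Pi.smul_apply, Matrix.col_apply, Module.Basis.toMatrix_apply, OrthonormalBasis.coe_toBasis_repr_apply,
    EuclideanSpace.basisFun_repr, h1]
  simp
  field_simp [hpos.ne']

lemma pg_trans [DecidableEq ι] [Nonempty ι] (x y : ι → ℂ) (h : pgN x = pgN y) :
    ∃ U ∈ unitaryGroup ι ℂ, U *ᵥ x = y := by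
  obtain ⟨i0⟩ := ‹Nonempty ι›
  obtain ⟨U, hU, hx⟩ := pg_trans0 i0 x
  obtain ⟨V, hV, hy⟩ := pg_trans0 i0 y
  refine ⟨V * star U, mul_mem hV (Unitary.star_mem hU), ?_⟩
  rw [h] at hx
  rw [← hx, mulVec_mulVec, mul_assoc, (mem_unitaryGroup_iff').1 hU, mul_one, hy]

lemma PgInv.char [DecidableEq ι] [Nonempty ι] {μ : Measure (ι → ℂ)} (hμ : PgInv μ)
    {w w' : ι → ℂ} (h : pgN w = pgN w') :
    ∫ v, Complex.exp (pgB v w * Complex.I) ∂μ = ∫ v, Complex.exp (pgB v w' * Complex.I) ∂μ := by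
  obtain ⟨U, hU, rfl⟩ := pg_trans w w' h
  have hc : Continuous (fun v => Complex.exp (pgB v (U *ᵥ w) * Complex.I)) := by
    have : Continuous (fun v => pgB v (U *ᵥ w)) :=
      pgB_cont.comp (by fun_prop : Continuous fun v => (v, U *ᵥ w))
    fun_prop
  rw [← hμ.integral hU hc]
  simp_rw [pgB_mulVec, mulVec_mulVec, ← star_eq_conjTranspose, (mem_unitaryGroup_iff').1 hU, one_mulVec]

lemma pg_polar [DecidableEq ι] [Nonempty ι] {M μ : Measure (ι → ℂ)} [IsFiniteMeasure M]
    [IsProbabilityMeasure μ] (hM : PgInv M) (hμ : PgInv μ) (hs : ∀ᵐ ψ ∂μ, pgN ψ = 1) :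
    (M.prod μ).map (fun p => Real.sqrt (pgN p.1) • p.2) = M := by
  have hcont : Continuous (fun p : (ι → ℂ) × (ι → ℂ) => Real.sqrt (pgN p.1) • p.2) :=
    ((pgN_cont.comp continuous_fst).sqrt).smul continuous_snd
  have hBc : ∀ w, Continuous (fun v : ι → ℂ => pgB v w) := fun w =>
    pgB_cont.comp (by fun_prop : Continuous fun v => (v, w))
  refine pg_ext fun w => ?_
  have hBw := hBc w
  rw [integral_map hcont.aemeasurable (by
    refine Continuous.aestronglyMeasurable ?_
    fun_prop)]
  have hint : Integrable (fun p : (ι → ℂ) × (ι → ℂ) =>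
      Complex.exp (pgB p.2 (Real.sqrt (pgN w) • p.1) * Complex.I)) (M.prod μ) := by
    have hc : Continuous (fun p : (ι → ℂ) × (ι → ℂ) => pgB p.2 (Real.sqrt (pgN w) • p.1)) :=
      pgB_cont.comp (by fun_prop : Continuous fun p : (ι → ℂ) × (ι → ℂ) => (p.2, Real.sqrt (pgN w) • p.1))
    refine Integrable.of_bound (C := 1) (by
      refine Continuous.aestronglyMeasurable ?_
      fun_prop) (Filter.Eventually.of_forall fun p => ?_)
    rw [Complex.norm_exp_ofReal_mul_I]
  have hint' : Integrable (fun p : (ι → ℂ) × (ι → ℂ) =>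
      Complex.exp (pgB (Real.sqrt (pgN p.1) • p.2) w * Complex.I)) (M.prod μ) := by
    refine Integrable.of_bound (C := 1) (by
      refine Continuous.aestronglyMeasurable ?_
      fun_prop) (Filter.Eventually.of_forall fun p => ?_)
    rw [Complex.norm_exp_ofReal_mul_I]
  rw [integral_prod _ hint']
  have e1 : ∀ X : ι → ℂ, ∫ ψ, Complex.exp (pgB (Real.sqrt (pgN X) • ψ) w * Complex.I) ∂μ
      = ∫ ψ, Complex.exp (pgB ψ (Real.sqrt (pgN w) • X) * Complex.I) ∂μ := by
    intro X
    simp_rw [pgB_smul_left, ← pgB_smul_right]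
    refine hμ.char ?_
    rw [pgN_smul, pgN_smul, Real.sq_sqrt (pgN_nonneg _), Real.sq_sqrt (pgN_nonneg _), mul_comm]
  simp_rw [e1]
  rw [integral_integral_swap (f := fun X ψ => Complex.exp (pgB ψ (Real.sqrt (pgN w) • X) * Complex.I)) hint]
  have e2 : ∀ᵐ ψ ∂μ, ∫ X, Complex.exp (pgB ψ (Real.sqrt (pgN w) • X) * Complex.I) ∂M
      = ∫ v, Complex.exp (pgB v w * Complex.I) ∂M := by
    filter_upwards [hs] with ψ hψ
    have : ∀ X, pgB ψ (Real.sqrt (pgN w) • X) = pgB X (Real.sqrt (pgN w) • ψ) := fun X => by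
      rw [pgB_smul_right, pgB_smul_right, pgB_comm]
    simp_rw [this]
    refine hM.char ?_
    rw [pgN_smul, Real.sq_sqrt (pgN_nonneg _), hψ, mul_one]
  rw [integral_congr_ae e2]
  simp

lemma pg_homog [DecidableEq ι] [Nonempty ι] {M μ : Measure (ι → ℂ)} [IsFiniteMeasure M]
    [IsProbabilityMeasure μ] (hM : PgInv M) (hμ : PgInv μ) (hs : ∀ᵐ ψ ∂μ, pgN ψ = 1)
    {F : (ι → ℂ) → ℂ} (hF : Continuous F) (k : ℕ) (hk : ∀ (c : ℝ) x, F (c • x) = (c : ℂ) ^ (2 * k) * F x) :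
    ∫ x, F x ∂M = (∫ x, ((pgN x : ℝ) : ℂ) ^ k ∂M) * ∫ x, F x ∂μ := by
  conv_lhs => rw [← pg_polar hM hμ hs]
  have hcont : Continuous (fun p : (ι → ℂ) × (ι → ℂ) => Real.sqrt (pgN p.1) • p.2) :=
    ((pgN_cont.comp continuous_fst).sqrt).smul continuous_snd
  rw [integral_map hcont.aemeasurable hF.aestronglyMeasurable, ← integral_prod_mul]
  congr 1
  funext p
  rw [hk, pow_mul, ← Complex.ofReal_pow, Real.sq_sqrt (pgN_nonneg _)]

end PageInv


section PageH
open scoped Real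
variable {ι : Type*} [Fintype ι]

/-- complete homogeneous symmetric function -/
noncomputable def pgH (l : ι → ℂ) (a : ℕ) : ℂ :=
  PowerSeries.coeff a (∏ i, PowerSeries.mk (fun j => l i ^ j))

/-- signed elementary symmetric function -/
noncomputable def pgE (l : ι → ℂ) (a : ℕ) : ℂ :=
  Polynomial.coeff (∏ i, (1 - Polynomial.C (l i) * Polynomial.X)) a

lemma pgH_eq [DecidableEq ι] (l : ι → ℂ) (a : ℕ) :
    pgH l a = ∑ k ∈ Finset.piAntidiag Finset.univ a, ∏ i, l i ^ (k i) := by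
  rw [pgH, PowerSeries.coeff_prod]
  refine Finset.sum_bij (fun f _ => (f : ι → ℕ)) ?_ ?_ ?_ ?_
  · intro f hf
    simpa [Finset.mem_finsuppAntidiag] using hf
  · intro f _ g _ h
    exact DFunLike.coe_injective h
  · intro k hk
    refine ⟨Finsupp.equivFunOnFinite.symm k, ?_, by simp⟩
    simpa [Finset.mem_finsuppAntidiag] using hk
  · intro f _
    simp

lemma pg_gauss_pow [DecidableEq ι] (l : ι → ℂ) (a : ℕ) :
    ∫ z, (∑ i, l i * (Complex.normSq (z i) : ℂ)) ^ a ∂(pgG ι) = (a.factorial : ℂ) * pgH l a := by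
  simp_rw [Finset.sum_pow_eq_sum_piAntidiag]
  have hp : ∀ (k : ι → ℕ), ∫ z, ∏ i, (l i * (Complex.normSq (z i) : ℂ)) ^ k i ∂(pgG ι)
      = ∏ i, (l i ^ k i * ((k i).factorial : ℂ)) := by
    intro k
    rw [pgG, integral_fintype_prod_eq_prod (f := fun i (z : ℂ) => (l i * (Complex.normSq z : ℂ)) ^ k i)]
    refine Finset.prod_congr rfl fun i _ => ?_
    simp_rw [mul_pow]
    rw [integral_const_mul]
    congr 1
    have := congrArg (fun r : ℝ => (r : ℂ)) (pgGam_moment (k i))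
    simp only [Complex.ofReal_natCast] at this
    rw [← this, ← integral_complex_ofReal]
    congr 1; ext z
    rw [pow_mul, Complex.normSq_eq_norm_sq]; push_cast; rfl
  rw [integral_finsetSum]
  · rw [pgH_eq, Finset.mul_sum]
    refine Finset.sum_congr rfl fun k hk => ?_
    rw [integral_const_mul, hp, Finset.prod_mul_distrib, mul_comm, mul_assoc, mul_comm]
    congr 1
    rw [mul_comm]
    have h1 : ∑ i, k i = a := by simpa using hk
    have h2 := Nat.multinomial_spec (Finset.univ) k
    rw [h1] at h2
    rw [← h2]; push_cast; ring
  · intro k _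
    refine pgPG_int (pgG_mom ι) ?_
    have hc : ∀ i, (fun z : ι → ℂ => z i) ∈ PgPG (ι → ℂ) := fun i =>
      pgPG_clm (ContinuousLinearMap.proj (R := ℝ) (φ := fun _ : ι => ℂ) i)
    have hn : ∀ i, (fun z : ι → ℂ => l i * (Complex.normSq (z i) : ℂ)) ∈ PgPG (ι → ℂ) := fun i => by
      have := mul_mem (Subalgebra.algebraMap_mem (PgPG (ι → ℂ)) (l i)) (mul_mem (pgPG_star (hc i)) (hc i))
      refine (congrArg (· ∈ PgPG (ι → ℂ)) ?_).mp this
      funext z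
      simp [Complex.normSq_eq_conj_mul_self]
    have := mul_mem (Subalgebra.algebraMap_mem (PgPG (ι → ℂ)) ((Nat.multinomial Finset.univ k : ℕ) : ℂ))
      (prod_mem (t := Finset.univ) fun i _ => pow_mem (hn i) (k i))
    refine (congrArg (· ∈ PgPG (ι → ℂ)) ?_).mp this
    funext z
    simp

lemma pgH_one [DecidableEq ι] [Nonempty ι] (a : ℕ) :
    pgH (fun _ : ι => (1 : ℂ)) a = ((Fintype.card ι - 1 + a).choose (Fintype.card ι - 1) : ℕ) := by
  rw [pgH]
  obtain ⟨d, hd⟩ : ∃ d, Fintype.card ι = d + 1 := ⟨_, (Nat.succ_pred_eq_of_pos Fintype.card_pos).symm⟩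
  simp only [one_pow, Finset.prod_const, Finset.card_univ]
  have : (PowerSeries.mk fun _ => (1 : ℂ)) = PowerSeries.mk 1 := rfl
  rw [this, hd, PowerSeries.mk_one_pow_eq_mk_choose_add, PowerSeries.coeff_mk]
  simp

lemma pgN_moment [DecidableEq ι] [Nonempty ι] (a : ℕ) :
    ∫ z, ((pgN z : ℝ) : ℂ) ^ a ∂(pgG ι) = ((Fintype.card ι).ascFactorial a : ℕ) := by
  have := pg_gauss_pow (fun _ : ι => (1 : ℂ)) a
  simp only [one_mul, ← Complex.ofReal_sum] at this
  unfold pgN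
  rw [this, pgH_one]
  obtain ⟨d, hd⟩ : ∃ d, Fintype.card ι = d + 1 := ⟨_, (Nat.succ_pred_eq_of_pos Fintype.card_pos).symm⟩
  rw [hd, Nat.ascFactorial_eq_factorial_mul_choose, ← Nat.cast_mul]
  congr 2
  simp [Nat.choose_symm_add]

lemma pg_gauss_herm [DecidableEq ι] {W : Matrix ι ι ℂ} (hW : W.IsHermitian) (a : ℕ) :
    ∫ z, (star z ⬝ᵥ W *ᵥ z) ^ a ∂(pgG ι) =
      (a.factorial : ℂ) * pgH (fun i => (hW.eigenvalues i : ℂ)) a := by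
  have hU : (hW.eigenvectorUnitary : Matrix ι ι ℂ) ∈ unitaryGroup ι ℂ := hW.eigenvectorUnitary.2
  rw [← pg_gauss_pow, ← (pgG_inv (ι := ι)).integral hU (by fun_prop)]
  congr 1; funext z; congr 1
  rw [star_mulVec, ← dotProduct_mulVec, mulVec_mulVec, mulVec_mulVec]
  have h1 := hW.spectral_theorem
  rw [Unitary.conjStarAlgAut_apply] at h1
  have h2 : (hW.eigenvectorUnitary : Matrix ι ι ℂ)ᴴ * (W * (hW.eigenvectorUnitary : Matrix ι ι ℂ)) =
      diagonal (RCLike.ofReal ∘ hW.eigenvalues) := by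
    have h3 := (mem_unitaryGroup_iff').1 hU
    rw [← star_eq_conjTranspose]
    generalize (hW.eigenvectorUnitary : Matrix ι ι ℂ) = V at *
    generalize diagonal ((RCLike.ofReal : ℝ → ℂ) ∘ hW.eigenvalues) = D at *
    subst h1
    simp only [mul_assoc]
    rw [h3, mul_one, ← mul_assoc, h3, one_mul]
  rw [mul_assoc, h2]
  simp only [dotProduct, mulVec_diagonal]
  refine Finset.sum_congr rfl fun i _ => ?_
  rw [Complex.normSq_eq_conj_mul_self]
  simp; ring

lemma pg_geom_mul (x : ℂ) : PowerSeries.mk (fun j => x ^ j) *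
    ((1 - Polynomial.C x * Polynomial.X : Polynomial ℂ) : PowerSeries ℂ) = 1 := by
  ext k
  have : ((1 - Polynomial.C x * Polynomial.X : Polynomial ℂ) : PowerSeries ℂ)
      = 1 - PowerSeries.C x * PowerSeries.X := by simp
  rw [this, mul_sub, mul_one, ← mul_assoc, map_sub]
  cases k with
  | zero => simp
  | succ k => simp [PowerSeries.coeff_succ_mul_X, PowerSeries.coeff_one, pow_succ]

lemma pg_geom_deriv (x : ℂ) : PowerSeries.X * PowerSeries.derivative ℂ (PowerSeries.mk (fun j => x ^ j)) *
    ((1 - Polynomial.C x * Polynomial.X : Polynomial ℂ) : PowerSeries ℂ) =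
    PowerSeries.mk (fun j => if j = 0 then 0 else x ^ j) := by
  ext k
  have : ((1 - Polynomial.C x * Polynomial.X : Polynomial ℂ) : PowerSeries ℂ)
      = 1 - PowerSeries.C x * PowerSeries.X := by simp
  rw [this, mul_sub, mul_one, mul_comm (PowerSeries.C x), ← mul_assoc, map_sub, mul_comm PowerSeries.X]
  cases k with
  | zero => simp
  | succ k =>
    rw [PowerSeries.coeff_mul_C, PowerSeries.coeff_succ_mul_X, PowerSeries.coeff_succ_mul_X]
    cases k with
    | zero => simp [PowerSeries.coeff_derivative]
    | succ k =>
      rw [PowerSeries.coeff_succ_mul_X]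
      simp [PowerSeries.coeff_derivative]; ring

lemma pg_newton (l : ι → ℂ) (k : ℕ) (hk : k ≠ 0) :
    ∑ i, l i ^ k = ∑ p ∈ Finset.HasAntidiagonal.antidiagonal k, (p.1 : ℂ) * pgH l p.1 * pgE l p.2 := by
  classical
  have key : ∀ s : Finset ι,
      PowerSeries.X * PowerSeries.derivative ℂ (∏ i ∈ s, PowerSeries.mk (fun j => l i ^ j)) *
        ((∏ i ∈ s, (1 - Polynomial.C (l i) * Polynomial.X) : Polynomial ℂ) : PowerSeries ℂ) =
      ∑ i ∈ s, PowerSeries.mk (fun j => if j = 0 then 0 else l i ^ j) ∧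
      (∏ i ∈ s, PowerSeries.mk (fun j => l i ^ j)) *
        ((∏ i ∈ s, (1 - Polynomial.C (l i) * Polynomial.X) : Polynomial ℂ) : PowerSeries ℂ) = 1 := by
    intro s
    induction s using Finset.induction_on with
    | empty => simp
    | insert i s hi ih =>
      rw [Finset.prod_insert hi, Finset.prod_insert hi, Finset.sum_insert hi, Derivation.leibniz,
        Polynomial.coe_mul, ← pg_geom_deriv, ← ih.1]
      have h1 := pg_geom_mul (l i)
      have h2 := ih.2
      constructor
      · simp only [smul_eq_mul]
        linear_combination (PowerSeries.X * PowerSeries.derivative ℂ (∏ i ∈ s, PowerSeries.mk (fun j => l i ^ j)) *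
        ((∏ i ∈ s, (1 - Polynomial.C (l i) * Polynomial.X) : Polynomial ℂ) : PowerSeries ℂ)) * h1 + (PowerSeries.X * PowerSeries.derivative ℂ (PowerSeries.mk (fun j => l i ^ j)) *
    ((1 - Polynomial.C (l i) * Polynomial.X : Polynomial ℂ) : PowerSeries ℂ)) * h2
      · linear_combination ((∏ i ∈ s, PowerSeries.mk (fun j => l i ^ j)) *
        ((∏ i ∈ s, (1 - Polynomial.C (l i) * Polynomial.X) : Polynomial ℂ) : PowerSeries ℂ)) * h1 + h2
  have h := congrArg (PowerSeries.coeff k) (key Finset.univ).1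
  rw [map_sum] at h
  simp only [PowerSeries.coeff_mk, hk, if_false] at h
  rw [← h, PowerSeries.coeff_mul]
  refine Finset.sum_congr rfl fun p _ => ?_
  rw [Polynomial.coeff_coe, pgE, pgH]
  congr 1
  rw [mul_comm PowerSeries.X]
  rcases p with ⟨a, b⟩
  cases a with
  | zero => simp
  | succ a =>
    rw [PowerSeries.coeff_succ_mul_X, PowerSeries.coeff_derivative]
    push_cast; ring

end PageH


section PageChar
open scoped Real

lemma pg_derivative_det {n : Type*} [Fintype n] [DecidableEq n] (M : Matrix n n (Polynomial ℂ)) :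
    Polynomial.derivative M.det = ∑ i, (M.updateCol i (fun j => Polynomial.derivative (M j i))).det := by
  have h1 : ∀ σ : Equiv.Perm n, Polynomial.derivative (Equiv.Perm.sign σ • ∏ i, M (σ i) i) =
      ∑ i, Equiv.Perm.sign σ • ((∏ j ∈ Finset.univ.erase i, M (σ j) j) * Polynomial.derivative (M (σ i) i)) := by
    intro σ
    rw [← Finset.smul_sum, ← Polynomial.derivative_prod_finset]
    rcases Int.units_eq_one_or (Equiv.Perm.sign σ) with h | h <;> rw [h] <;> simp
  rw [det_apply, Polynomial.derivative_sum, Finset.sum_congr rfl fun σ _ => h1 σ]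
  simp_rw [det_apply]
  rw [Finset.sum_comm]
  refine Finset.sum_congr rfl fun i _ => Finset.sum_congr rfl fun σ _ => ?_
  congr 1
  rw [← Finset.mul_prod_erase _ _ (Finset.mem_univ i), updateCol_self, mul_comm]
  congr 1
  refine Finset.prod_congr rfl fun j hj => ?_
  rw [updateCol_ne (Finset.ne_of_mem_erase hj)]

lemma pg_derivative_charpoly {n : Type*} [Fintype n] [DecidableEq n] (A : Matrix n n ℂ) :
    Polynomial.derivative A.charpoly = ∑ i, adjugate (charmatrix A) i i := by
  rw [charpoly, pg_derivative_det]
  refine Finset.sum_congr rfl fun i _ => ?_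
  have e : (charmatrix A).adjugate i i = ((charmatrix A).updateCol i (Pi.single i 1)).det := by
    rw [← transpose_apply (charmatrix A).adjugate, adjugate_transpose, adjugate_apply, updateRow_transpose, det_transpose]
  rw [e]
  congr 2
  funext j
  by_cases h : j = i
  · subst h; simp [charmatrix_apply]
  · simp [charmatrix_apply, h]

lemma pg_det_rank_one {n R : Type*} [Fintype n] [DecidableEq n] [CommRing R] [IsDomain R]
    (A : Matrix n n R) (hA : A.det ≠ 0) (u v : n → R) :
    (A + vecMulVec u v).det = A.det + v ⬝ᵥ (adjugate A *ᵥ u) := by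
  let K := FractionRing R
  let f : R →+* K := algebraMap R K
  have hf : Function.Injective f := IsFractionRing.injective R K
  apply hf
  have h1 : (f.mapMatrix A).det ≠ 0 := by
    rw [← RingHom.map_det]
    exact fun h => hA (hf (h.trans (map_zero f).symm))
  have h2 := det_add_replicateCol_mul_replicateRow (ι := Unit) (A := f.mapMatrix A) (isUnit_iff_ne_zero.2 h1)
    (f ∘ u) (f ∘ v)
  rw [RingHom.map_det, map_add]
  have h3 : f.mapMatrix (vecMulVec u v) = replicateCol Unit (f ∘ u) * replicateRow Unit (f ∘ v) := by
    ext i j; simp [vecMulVec_apply, mul_apply]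
  rw [h3, h2, map_add, RingHom.map_det]
  have h4 : f (v ⬝ᵥ (adjugate A *ᵥ u)) = (f ∘ v) ⬝ᵥ (adjugate (f.mapMatrix A) *ᵥ (f ∘ u)) := by
    rw [← RingHom.map_adjugate]
    simp [dotProduct, mulVec]
  rw [h4, inv_def, Ring.inverse_eq_inv']
  have h5 : (replicateRow Unit (f ∘ v) * ((f.mapMatrix A).det⁻¹ • adjugate (f.mapMatrix A)) *
      replicateCol Unit (f ∘ u)) default default =
      (f.mapMatrix A).det⁻¹ * ((f ∘ v) ⬝ᵥ (adjugate (f.mapMatrix A) *ᵥ (f ∘ u))) := by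
    rw [Matrix.mul_smul, Matrix.smul_mul, Matrix.mul_assoc]
    rfl
  rw [det_unique (n := Unit), Matrix.add_apply, h5]
  simp only [one_apply_eq]
  rw [mul_add, mul_one, ← mul_assoc, mul_inv_cancel₀ h1, one_mul]

lemma pg_charpoly_rank_one {n : Type*} [Fintype n] [DecidableEq n] (A : Matrix n n ℂ) (u v : n → ℂ) :
    (A + vecMulVec u v).charpoly = A.charpoly -
      ∑ i, ∑ j, Polynomial.C (v i * u j) * adjugate (charmatrix A) i j := by
  have h : charmatrix (A + vecMulVec u v) = charmatrix A +
      vecMulVec (fun i => - Polynomial.C (u i)) (fun i => Polynomial.C (v i)) := by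
    ext1 i j
    simp [charmatrix_apply, vecMulVec_apply]; ring
  rw [charpoly, h, pg_det_rank_one _ (charpoly_monic A).ne_zero, ← charpoly, sub_eq_add_neg]
  congr 1
  simp only [dotProduct, mulVec, Finset.mul_sum, ← Finset.sum_neg_distrib]
  refine Finset.sum_congr rfl fun i _ => Finset.sum_congr rfl fun j _ => ?_
  rw [Polynomial.C_mul]; ring

lemma pg_second_moment {ι : Type*} [Fintype ι] [DecidableEq ι] (k l : ι) :
    ∫ x, x k * star (x l) ∂(pgG ι) = if k = l then 1 else 0 := by
  split_ifs with h
  · subst h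
    have h1 : MeasurePreserving (Function.eval k) (pgG ι) pgGam := measurePreserving_eval _ k
    have h2 : ∫ z, z * star z ∂pgGam = 1 := by
      have := congrArg (fun r : ℝ => (r : ℂ)) (pgGam_moment 1)
      simp only [Complex.ofReal_natCast, Nat.factorial_one, Nat.cast_one, Complex.ofReal_one] at this
      rw [← this, ← integral_complex_ofReal]
      congr 1; ext z
      rw [mul_one, RCLike.star_def, Complex.mul_conj, Complex.normSq_eq_norm_sq]
    rw [← h2, ← h1.map_eq, integral_map h1.measurable.aemeasurable
      (by exact (by fun_prop : Continuous fun z : ℂ => z * star z).aestronglyMeasurable)]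
  · let U : Matrix ι ι ℂ := diagonal (fun i => if i = k then -1 else 1)
    have hU : U ∈ unitaryGroup ι ℂ := by
      rw [mem_unitaryGroup_iff, star_eq_conjTranspose, diagonal_conjTranspose, diagonal_mul_diagonal]
      rw [← diagonal_one]
      congr 1; funext i
      by_cases h : i = k <;> simp [h]
    have := (pgG_inv (ι := ι)).integral hU (f := fun x => x k * star (x l)) (by fun_prop)
    simp only [U, mulVec_diagonal, if_true, if_neg (Ne.symm h), one_mul, neg_mul, integral_neg] at this
    have h2 : (2 : ℂ) * ∫ x, x k * star (x l) ∂(pgG ι) = 0 := by linear_combination (-1 : ℂ) * this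
    simpa using h2

lemma pgPG_coeff {E : Type*} [NormedAddCommGroup E] {n : Type*} [Fintype n] [DecidableEq n]
    (M : E → Matrix n n ℂ) (hM : ∀ i j, (fun x => M x i j) ∈ PgPG E) (k : ℕ) :
    (fun x => (M x).charpoly.coeff k) ∈ PgPG E := by
  have key : ∀ p : MvPolynomial (n × n) ℂ,
      (fun x => MvPolynomial.eval₂Hom (RingHom.id ℂ) (fun ij : n × n => M x ij.1 ij.2) p) ∈ PgPG E := by
    intro p
    induction p using MvPolynomial.induction_on with
    | C a =>
      have h := Subalgebra.algebraMap_mem (PgPG E) a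
      have e : (fun x => MvPolynomial.eval₂Hom (RingHom.id ℂ) (fun ij : n × n => M x ij.1 ij.2) (MvPolynomial.C a)) =
          algebraMap ℂ (E → ℂ) a := by
        funext x
        simp
      rw [e]; exact h
    | add p q hp hq => simp only [map_add]; exact add_mem hp hq
    | mul_X p i hp =>
      simp only [map_mul, MvPolynomial.coe_eval₂Hom, MvPolynomial.eval₂_X] at hp ⊢
      exact mul_mem hp (hM i.1 i.2)
  have := key ((charpoly.univ ℂ n).coeff k)
  simp only [charpoly.univ_coeff_eval₂Hom] at this
  exact this

/-- the operator `1 - d/dX` -/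
noncomputable def pgT (p : Polynomial ℂ) : Polynomial ℂ := p - Polynomial.derivative p

lemma pgPG_coord {ι : Type*} [Fintype ι] (i : ι) : (fun z : ι → ℂ => z i) ∈ PgPG (ι → ℂ) :=
  pgPG_clm (ContinuousLinearMap.proj (R := ℝ) (φ := fun _ : ι => ℂ) i)

lemma pg_row_step {n : Type*} [Fintype n] [DecidableEq n] (A : Matrix n n ℂ) (k : ℕ) :
    ∫ x, (A + vecMulVec (star x) x).charpoly.coeff k ∂(pgG n) = (pgT A.charpoly).coeff k := by
  simp_rw [pg_charpoly_rank_one, Polynomial.coeff_sub, Polynomial.finsetSum_coeff, Polynomial.coeff_C_mul,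
    Pi.star_apply]
  have hI : ∀ i j : n, Integrable (fun x : n → ℂ => x i * star (x j) * (adjugate (charmatrix A) i j).coeff k) (pgG n) :=
    fun i j => (pgPG_int (pgG_mom n) (mul_mem (pgPG_coord i) (pgPG_star (pgPG_coord j)))).mul_const _
  rw [integral_sub (integrable_const _) (integrable_finsetSum _ fun i _ => integrable_finsetSum _ fun j _ => hI i j),
    integral_finsetSum _ (fun i _ => integrable_finsetSum _ fun j _ => hI i j)]
  simp_rw [integral_finsetSum _ (fun j _ => hI _ j), integral_mul_const, pg_second_moment]
  simp [pgT, pg_derivative_charpoly, Polynomial.finsetSum_coeff]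

end PageChar


section PageRows
variable {n : Type*} [Fintype n] [DecidableEq n]

noncomputable def pgR (r : ℕ) (n : Type*) [Fintype n] : Measure (Fin r → n → ℂ) :=
  Measure.pi (fun _ => pgG n)

instance pgR_prob (r : ℕ) (n : Type*) [Fintype n] : IsProbabilityMeasure (pgR r n) := by
  unfold pgR; infer_instance

lemma pgR_mom (r : ℕ) (n : Type*) [Fintype n] : PgMom (pgR r n) := pgMom_pi (pgG_mom n)

lemma pgR_split (r : ℕ) (f : (n → ℂ) × (Fin r → n → ℂ) → ℂ) :
    ∫ X, f (X 0, fun k => X k.succ) ∂(pgR (r + 1) n) = ∫ p, f p ∂((pgG n).prod (pgR r n)) := by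
  have h := measurePreserving_piFinSuccAbove (fun _ : Fin (r + 1) => pgG n) 0
  rw [pgR, pgR, ← h.integral_comp']
  rfl

lemma pgPG_vec {E : Type*} [NormedAddCommGroup E] [NormedSpace ℝ E] (L : E →L[ℝ] (n → ℂ)) (i j : n) :
    (fun x => vecMulVec (star (L x)) (L x) i j) ∈ PgPG E := by
  simp only [vecMulVec_apply, Pi.star_apply]
  exact mul_mem (pgPG_star (pgPG_comp L (pgPG_coord i))) (pgPG_comp L (pgPG_coord j))

lemma pgPG_vsum {E : Type*} [NormedAddCommGroup E] [NormedSpace ℝ E] {r : ℕ}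
    (L : E →L[ℝ] (Fin r → n → ℂ)) (i j : n) :
    (fun x => (∑ k, vecMulVec (star (L x k)) (L x k)) i j) ∈ PgPG E := by
  simp only [Matrix.sum_apply]
  have := sum_mem (S := PgPG E) (t := Finset.univ) (f := fun k : Fin r => fun x => vecMulVec (star (L x k)) (L x k) i j)
    (fun k _ => pgPG_vec ((ContinuousLinearMap.proj (R := ℝ) (φ := fun _ : Fin r => n → ℂ) k).comp L) i j)
  convert this using 1
  funext x
  simp

lemma pgPG_joint (A : Matrix n n ℂ) (r i : ℕ) :
    (fun p : (n → ℂ) × (Fin r → n → ℂ) => (A + vecMulVec (star p.1) p.1 +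
      ∑ k, vecMulVec (star (p.2 k)) (p.2 k)).charpoly.coeff i) ∈ PgPG ((n → ℂ) × (Fin r → n → ℂ)) := by
  refine pgPG_coeff _ (fun a b => ?_) i
  have h1 := pgPG_vec (E := (n → ℂ) × (Fin r → n → ℂ)) (ContinuousLinearMap.fst ℝ (n → ℂ) (Fin r → n → ℂ)) a b
  have h2 := pgPG_vsum (E := (n → ℂ) × (Fin r → n → ℂ)) (ContinuousLinearMap.snd ℝ (n → ℂ) (Fin r → n → ℂ)) a b
  have h0 := Subalgebra.algebraMap_mem (PgPG ((n → ℂ) × (Fin r → n → ℂ))) (A a b)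
  have h3 := add_mem (add_mem h0 h1) h2
  exact h3

lemma pg_rows (r : ℕ) : ∀ (A : Matrix n n ℂ) (i : ℕ),
    ∫ X, (A + ∑ k, vecMulVec (star (X k)) (X k)).charpoly.coeff i ∂(pgR r n) =
      (pgT^[r] A.charpoly).coeff i := by
  induction r with
  | zero => intro A i; simp
  | succ r ih =>
    intro A i
    have h1 := pgR_split r (fun p : (n → ℂ) × (Fin r → n → ℂ) => (A + vecMulVec (star p.1) p.1 +
      ∑ k, vecMulVec (star (p.2 k)) (p.2 k)).charpoly.coeff i)
    simp only [add_assoc] at h1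
    rw [integral_prod_symm _ (by
      have := pgPG_int (pgMom_prod (pgG_mom n) (pgR_mom r n)) (pgPG_joint A r i)
      simpa only [add_assoc] using this)] at h1
    have h2 : ∀ Y : Fin r → n → ℂ, ∫ x, (A + (vecMulVec (star x) x +
        ∑ k, vecMulVec (star (Y k)) (Y k))).charpoly.coeff i ∂(pgG n) =
        (A + ∑ k, vecMulVec (star (Y k)) (Y k)).charpoly.coeff i -
        (A + ∑ k, vecMulVec (star (Y k)) (Y k)).charpoly.coeff (i + 1) * (i + 1) := by
      intro Y
      have := pg_row_step (A + ∑ k, vecMulVec (star (Y k)) (Y k)) i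
      rw [pgT, Polynomial.coeff_sub, Polynomial.coeff_derivative] at this
      rw [← this]
      congr 1; funext x; congr 2; abel
    simp only [h2] at h1
    have hI : ∀ i, Integrable (fun Y : Fin r → n → ℂ =>
        (A + ∑ k, vecMulVec (star (Y k)) (Y k)).charpoly.coeff i) (pgR r n) := by
      intro i
      refine pgPG_int (pgR_mom r n) (pgPG_coeff _ (fun a b => ?_) i)
      have h1 := pgPG_vsum (ContinuousLinearMap.id ℝ (Fin r → n → ℂ)) a b
      have h0 := Subalgebra.algebraMap_mem (PgPG (Fin r → n → ℂ)) (A a b)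
      have h3 := add_mem h0 h1
      exact h3
    rw [integral_sub (hI i) ((hI (i + 1)).mul_const _), integral_mul_const, ih, ih] at h1
    have h3 : ∀ X : Fin (r + 1) → n → ℂ, ∑ k, vecMulVec (star (X k)) (X k) =
        vecMulVec (star (X 0)) (X 0) + ∑ k : Fin r, vecMulVec (star (X k.succ)) (X k.succ) :=
      fun X => Fin.sum_univ_succ _
    simp only [h3]
    rw [h1, Function.iterate_succ_apply', pgT, Polynomial.coeff_sub, Polynomial.coeff_derivative]

lemma pgT_iter_sub (r : ℕ) (p q : Polynomial ℂ) (c : ℂ) :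
    pgT^[r] (p - c • q) = pgT^[r] p - c • pgT^[r] q := by
  induction r with
  | zero => rfl
  | succ r ih =>
    rw [Function.iterate_succ_apply', ih, Function.iterate_succ_apply', Function.iterate_succ_apply']
    simp only [pgT, Polynomial.derivative_sub, Polynomial.derivative_smul, smul_sub]
    abel

lemma pgT_iter_coeff (r N i : ℕ) : (pgT^[r] (Polynomial.X ^ N : Polynomial ℂ)).coeff i =
    if i ≤ N then (-1) ^ (N - i) * (r.choose (N - i) : ℂ) * (N.descFactorial (N - i) : ℂ) else 0 := by
  induction r generalizing i with
  | zero =>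
    rw [Function.iterate_zero, id, Polynomial.coeff_X_pow]
    split_ifs with h1 h2 h2
    · subst h1; simp
    · omega
    · obtain ⟨d, hd⟩ : ∃ d, N - i = d + 1 := ⟨N - i - 1, by omega⟩
      simp [hd]
    · rfl
  | succ r ih =>
    rw [Function.iterate_succ_apply', pgT, Polynomial.coeff_sub, Polynomial.coeff_derivative, ih, ih]
    rcases lt_trichotomy i N with h | h | h
    · obtain ⟨d, rfl⟩ : ∃ d, N = i + 1 + d := ⟨N - i - 1, by omega⟩
      rw [if_pos (by omega), if_pos (by omega), if_pos (by omega),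
        show i + 1 + d - i = d + 1 by omega, show i + 1 + d - (i + 1) = d by omega,
        Nat.descFactorial_succ, show i + 1 + d - d = i + 1 by omega, Nat.choose_succ_succ]
      push_cast
      ring
    · subst h; simp
    · rw [if_neg (by omega), if_neg (by omega), if_neg (by omega)]; simp

lemma pgPG_N : (fun x : n → ℂ => ((pgN x : ℝ) : ℂ)) ∈ PgPG (n → ℂ) := by
  have h : (fun x : n → ℂ => ((pgN x : ℝ) : ℂ)) = ∑ i, fun x : n → ℂ => star (x i) * x i := by
    funext x
    rw [← pgN_dot]; simp [dotProduct]
  rw [h]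
  exact sum_mem fun i _ => mul_mem (pgPG_star (pgPG_coord i)) (pgPG_coord i)

lemma pg_rows_weight [Nonempty n] (r a i : ℕ) :
    ∫ X, ((pgN (X 0) : ℝ) : ℂ) ^ a * (∑ k, vecMulVec (star (X k)) (X k)).charpoly.coeff i ∂(pgR (r + 1) n) =
      ((Fintype.card n).ascFactorial a : ℂ) * (pgT^[r] (Polynomial.X ^ (Fintype.card n))).coeff i -
      ((Fintype.card n).ascFactorial (a + 1) : ℂ) * (pgT^[r] (Polynomial.X ^ (Fintype.card n - 1))).coeff i := by
  have h3 : ∀ X : Fin (r + 1) → n → ℂ, ∑ k, vecMulVec (star (X k)) (X k) =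
      vecMulVec (star (X 0)) (X 0) + ∑ k : Fin r, vecMulVec (star (X k.succ)) (X k.succ) :=
    fun X => Fin.sum_univ_succ _
  have h1 := pgR_split r (fun p : (n → ℂ) × (Fin r → n → ℂ) => ((pgN p.1 : ℝ) : ℂ) ^ a *
    (vecMulVec (star p.1) p.1 + ∑ k, vecMulVec (star (p.2 k)) (p.2 k)).charpoly.coeff i)
  simp only [h3]
  have hJ := pgPG_joint (0 : Matrix n n ℂ) r i
  simp only [zero_add] at hJ
  have hI : Integrable (fun p : (n → ℂ) × (Fin r → n → ℂ) => ((pgN p.1 : ℝ) : ℂ) ^ a *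
    (vecMulVec (star p.1) p.1 + ∑ k, vecMulVec (star (p.2 k)) (p.2 k)).charpoly.coeff i)
      ((pgG n).prod (pgR r n)) :=
    pgPG_int (pgMom_prod (pgG_mom n) (pgR_mom r n))
      (mul_mem (pow_mem (pgPG_comp (E := (n → ℂ) × (Fin r → n → ℂ)) (F := n → ℂ)
        (ContinuousLinearMap.fst ℝ (n → ℂ) (Fin r → n → ℂ)) pgPG_N) a) hJ)
  rw [integral_prod _ hI] at h1
  rw [h1]
  simp only [integral_const_mul, pg_rows, charpoly_vecMulVec, pgT_iter_sub, Polynomial.coeff_sub,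
    Polynomial.coeff_smul, pgN_dot, smul_eq_mul, mul_sub, ← mul_assoc, ← pow_succ]
  have hN : ∀ b : ℕ, Integrable (fun x : n → ℂ => ((pgN x : ℝ) : ℂ) ^ b) (pgG n) := fun b =>
    pgPG_int (pgG_mom n) (pow_mem pgPG_N b)
  rw [integral_sub ((hN _).mul_const _) ((hN _).mul_const _), integral_mul_const, integral_mul_const,
    pgN_moment, pgN_moment]

end PageRows


section PageTransfer
open scoped ComplexOrder

lemma pgR_uncurry (m : ℕ) (n : Type*) [Fintype n] :
    (pgR m n).map (fun X => fun p : Fin m × n => X p.1 p.2) = pgG (Fin m × n) := by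
  symm
  have hm : Measurable (fun X : Fin m → n → ℂ => fun p : Fin m × n => X p.1 p.2) := by fun_prop
  refine Measure.pi_eq fun s hs => ?_
  rw [Measure.map_apply hm (MeasurableSet.univ_pi hs)]
  have : (fun X : Fin m → n → ℂ => fun p : Fin m × n => X p.1 p.2) ⁻¹' (Set.univ.pi s) =
      Set.univ.pi (fun k => Set.univ.pi (fun l => s (k, l))) := by
    ext X; simp
  rw [this, pgR, Measure.pi_pi, Fintype.prod_prod_type]
  refine Finset.prod_congr rfl fun k _ => ?_
  rw [pgG, Measure.pi_pi]

lemma pgR_integral (m : ℕ) (n : Type*) [Fintype n] {f : (Fin m × n → ℂ) → ℂ} (hf : Continuous f) :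
    ∫ ψ, f ψ ∂(pgG (Fin m × n)) = ∫ X, f (fun p => X p.1 p.2) ∂(pgR m n) := by
  have hm : Measurable (fun X : Fin m → n → ℂ => fun p : Fin m × n => X p.1 p.2) := by fun_prop
  rw [← pgR_uncurry, integral_map hm.aemeasurable hf.aestronglyMeasurable]

variable {m n : ℕ}

lemma pgDM_mul (ψ : Fin m × Fin n → ℂ) :
    reducedDM ψ = (Matrix.of fun k l => ψ (k, l)) * (Matrix.of fun k l => ψ (k, l))ᴴ := by
  ext i j
  simp [reducedDM, mul_apply]

lemma pgDM_herm (ψ : Fin m × Fin n → ℂ) : (reducedDM ψ).IsHermitian := by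
  rw [pgDM_mul]; exact isHermitian_mul_conjTranspose_self _

lemma pgDM_posSemidef (ψ : Fin m × Fin n → ℂ) : (reducedDM ψ).PosSemidef := by
  rw [pgDM_mul]; exact posSemidef_self_mul_conjTranspose _

lemma pgDM_rev (ψ : Fin m × Fin n → ℂ) : (reducedDM ψ).charpolyRev =
    (∑ k, vecMulVec (star (fun l => ψ (k, l))) (fun l => ψ (k, l))).charpolyRev := by
  have h : ∑ k, vecMulVec (star (fun l => ψ (k, l))) (fun l => ψ (k, l)) =
      (Matrix.of fun k l => ψ (k, l))ᴴ * (Matrix.of fun k l => ψ (k, l)) := by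
    ext i j
    simp [Matrix.sum_apply, vecMulVec_apply, mul_apply]
  rw [h, pgDM_mul, charpolyRev, charpolyRev, Matrix.map_mul, Matrix.map_mul, ← Matrix.smul_mul,
    det_one_sub_mul_comm, Matrix.mul_smul]

lemma pg_rev_coeff {ι : Type*} [Fintype ι] [DecidableEq ι] (A : Matrix ι ι ℂ) {j : ℕ}
    (hj : j ≤ Fintype.card ι) : A.charpolyRev.coeff j = A.charpoly.coeff (Fintype.card ι - j) := by
  rw [← reverse_charpoly, Polynomial.coeff_reverse, charpoly_natDegree_eq_dim, Polynomial.revAt_le hj]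

lemma pgE_rev {ι : Type*} [Fintype ι] [DecidableEq ι] {A : Matrix ι ι ℂ} (hA : A.IsHermitian) (j : ℕ) :
    pgE (fun i => (hA.eigenvalues i : ℂ)) j = A.charpolyRev.coeff j := by
  have h1 : (1 : Polynomial ℂ).reverse = 1 := Polynomial.reverse_C 1
  have h2 : (Polynomial.X : Polynomial ℂ).reverse = 1 := by
    rw [← one_mul Polynomial.X, Polynomial.reverse_mul_X, h1]
  have h : ∀ (s : Finset ι) (l : ι → ℂ), (∏ i ∈ s, (Polynomial.X - Polynomial.C (l i))).reverse =
      ∏ i ∈ s, (1 - Polynomial.C (l i) * Polynomial.X) := by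
    intro s l
    induction s using Finset.induction_on with
    | empty => simp [h1]
    | insert a s ha ih =>
      rw [Finset.prod_insert ha, Finset.prod_insert ha, Polynomial.reverse_mul_of_domain, ih]
      congr 1
      rw [sub_eq_add_neg, ← Polynomial.C_neg, Polynomial.reverse_add_C]
      simp [sub_eq_add_neg, h2]
  rw [← reverse_charpoly, hA.charpoly_eq, pgE]
  have := h Finset.univ (fun i => (hA.eigenvalues i : ℂ))
  rw [← this]; rfl

lemma pgPG_DM (i j : Fin m) : (fun ψ : Fin m × Fin n → ℂ => reducedDM ψ i j) ∈ PgPG _ := by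
  have := sum_mem (S := PgPG (Fin m × Fin n → ℂ)) (t := Finset.univ)
    (f := fun l : Fin n => fun ψ : Fin m × Fin n → ℂ => ψ (i, l) * star (ψ (j, l)))
    (fun l _ => mul_mem (pgPG_coord (i, l)) (pgPG_star (pgPG_coord (j, l))))
  convert this using 1
  funext ψ
  simp [reducedDM]

lemma pg_rev_coeff_zero {ι : Type*} [Fintype ι] [DecidableEq ι] (A : Matrix ι ι ℂ) {j : ℕ}
    (hj : Fintype.card ι < j) : A.charpolyRev.coeff j = 0 := by
  rw [← reverse_charpoly]
  refine Polynomial.coeff_eq_zero_of_natDegree_lt (lt_of_le_of_lt (Polynomial.reverse_natDegree_le _) ?_)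
  rwa [charpoly_natDegree_eq_dim]

lemma pgPG_rev (j : ℕ) : (fun ψ : Fin m × Fin n → ℂ => (reducedDM ψ).charpolyRev.coeff j) ∈ PgPG _ := by
  rcases le_or_gt j m with h | h
  · simp only [pg_rev_coeff _ (show j ≤ Fintype.card (Fin m) by simpa using h)]
    exact pgPG_coeff _ pgPG_DM _
  · simp only [pg_rev_coeff_zero _ (show Fintype.card (Fin m) < j by simpa using h)]
    exact zero_mem (PgPG (Fin m × Fin n → ℂ))

lemma pg_J (r a j : ℕ) [NeZero n] (hj : j ≤ n) :
    ∫ ψ : Fin (r + 1) × Fin n → ℂ, (reducedDM ψ 0 0) ^ a * (reducedDM ψ).charpolyRev.coeff j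
      ∂(pgG (Fin (r + 1) × Fin n)) =
    (n.ascFactorial a : ℂ) * (pgT^[r] (Polynomial.X ^ n)).coeff (n - j) -
      (n.ascFactorial (a + 1) : ℂ) * (pgT^[r] (Polynomial.X ^ (n - 1))).coeff (n - j) := by
  have hc : Continuous fun ψ : Fin (r + 1) × Fin n → ℂ =>
      (reducedDM ψ 0 0) ^ a * (reducedDM ψ).charpolyRev.coeff j :=
    pgPG_cont (mul_mem (pow_mem (pgPG_DM 0 0) a) (pgPG_rev j))
  rw [pgR_integral _ _ hc]
  have := pg_rows_weight (n := Fin n) r a (n - j)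
  rw [Fintype.card_fin] at this
  rw [← this]
  congr 1; funext X
  rw [pgDM_rev, pg_rev_coeff _ (by simpa using hj), Fintype.card_fin, ← pgN_dot]
  simp [reducedDM, dotProduct, mul_comm]

end PageTransfer


section PageMoments
open scoped Kronecker

lemma pg_trace_pow {ι : Type*} [Fintype ι] [DecidableEq ι] {A : Matrix ι ι ℂ} (hA : A.IsHermitian) (k : ℕ) :
    (A ^ k).trace = ∑ i, (hA.eigenvalues i : ℂ) ^ k := by
  have h1 : A ^ k = Unitary.conjStarAlgAut ℂ _ hA.eigenvectorUnitary
      ((diagonal (RCLike.ofReal ∘ hA.eigenvalues)) ^ k) := by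
    rw [map_pow, ← hA.spectral_theorem]
  rw [h1, Unitary.conjStarAlgAut_apply, trace_mul_cycle]
  simp [diagonal_pow, trace]

lemma pg_rev_comm {ι : Type*} [Fintype ι] [DecidableEq ι] (A B : Matrix ι ι ℂ) :
    (A * B).charpolyRev = (B * A).charpolyRev := by
  rw [charpolyRev, charpolyRev, Matrix.map_mul, Matrix.map_mul, ← Matrix.smul_mul,
    det_one_sub_mul_comm, Matrix.mul_smul]

variable {m n : ℕ}

lemma pgDM_act (V : Matrix (Fin m) (Fin m) ℂ) (ψ : Fin m × Fin n → ℂ) :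
    reducedDM ((V ⊗ₖ (1 : Matrix (Fin n) (Fin n) ℂ)) *ᵥ ψ) = V * reducedDM ψ * Vᴴ := by
  have h : (Matrix.of fun k l => ((V ⊗ₖ (1 : Matrix (Fin n) (Fin n) ℂ)) *ᵥ ψ) (k, l)) =
      V * (Matrix.of fun k l => ψ (k, l)) := by
    ext k l
    simp [mulVec, dotProduct, Fintype.sum_prod_type, kroneckerMap_apply, mul_apply, one_apply]
  rw [pgDM_mul, h, pgDM_mul, conjTranspose_mul]
  simp only [Matrix.mul_assoc]

noncomputable def pgJ (r n a j : ℕ) : ℂ :=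
    (n.ascFactorial a : ℂ) * (pgT^[r] (Polynomial.X ^ n)).coeff (n - j) -
      (n.ascFactorial (a + 1) : ℂ) * (pgT^[r] (Polynomial.X ^ (n - 1))).coeff (n - j)

lemma pg_fix_z (r a j : ℕ) [NeZero n] (hj : j ≤ n) (z : Fin (r + 1) → ℂ) :
    ∫ ψ : Fin (r + 1) × Fin n → ℂ, (star z ⬝ᵥ reducedDM ψ *ᵥ z) ^ a * (reducedDM ψ).charpolyRev.coeff j
      ∂(pgG (Fin (r + 1) × Fin n)) = ((pgN z : ℝ) : ℂ) ^ a * pgJ r n a j := by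
  obtain ⟨V, hV, hz⟩ := pg_trans0 0 z
  have hV' := (mem_unitaryGroup_iff).1 hV
  have hU : (Vᴴ ⊗ₖ (1 : Matrix (Fin n) (Fin n) ℂ)) ∈ unitaryGroup (Fin (r + 1) × Fin n) ℂ := by
    refine kronecker_mem_unitary ?_ (one_mem _)
    rw [← star_eq_conjTranspose]; exact Unitary.star_mem hV
  have hc : Continuous fun ψ : Fin (r + 1) × Fin n → ℂ => ((pgN z : ℝ) : ℂ) ^ a *
      ((reducedDM ψ 0 0) ^ a * (reducedDM ψ).charpolyRev.coeff j) :=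
    (pgPG_cont (mul_mem (pow_mem (pgPG_DM 0 0) a) (pgPG_rev j))).const_mul _
  rw [pgJ, ← pg_J r a j hj, ← integral_const_mul, ← (pgG_inv).integral hU hc]
  congr 1; funext ψ
  rw [pgDM_act, conjTranspose_conjTranspose, Matrix.mul_assoc, pg_rev_comm Vᴴ, Matrix.mul_assoc,
    ← star_eq_conjTranspose, hV', Matrix.mul_one, ← mul_assoc, ← mul_pow]
  congr 2
  have e : star z ⬝ᵥ reducedDM ψ *ᵥ z = star (Pi.single 0 (Real.sqrt (pgN z) : ℂ) : Fin (r + 1) → ℂ) ⬝ᵥ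
      (star V * (reducedDM ψ * V)) *ᵥ (Pi.single 0 (Real.sqrt (pgN z) : ℂ)) := by
    conv_lhs => rw [← hz]
    rw [star_mulVec, ← dotProduct_mulVec, mulVec_mulVec, mulVec_mulVec, star_eq_conjTranspose, Matrix.mul_assoc]
  rw [e, mulVec_single, ← Pi.single_star, single_dotProduct]
  simp only [Pi.smul_apply, MulOpposite.smul_eq_mul_unop, MulOpposite.unop_op, col_apply]
  have hs : (Real.sqrt (pgN z) : ℂ) * Real.sqrt (pgN z) = (pgN z : ℂ) := by
    rw [← Complex.ofReal_mul, Real.mul_self_sqrt (pgN_nonneg z)]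
  rw [RCLike.star_def, Complex.conj_ofReal, ← hs]
  ring

lemma pg_joint_int (r a j : ℕ) :
    Integrable (fun p : (Fin (r + 1) → ℂ) × (Fin (r + 1) × Fin n → ℂ) =>
      (star p.1 ⬝ᵥ reducedDM p.2 *ᵥ p.1) ^ a * (reducedDM p.2).charpolyRev.coeff j)
      ((pgG (Fin (r + 1))).prod (pgG (Fin (r + 1) × Fin n))) := by
  let E := (Fin (r + 1) → ℂ) × (Fin (r + 1) × Fin n → ℂ)
  let L1 : E →L[ℝ] (Fin (r + 1) → ℂ) := ContinuousLinearMap.fst ℝ _ _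
  let L2 : E →L[ℝ] (Fin (r + 1) × Fin n → ℂ) := ContinuousLinearMap.snd ℝ _ _
  have h1 : ∀ i k : Fin (r + 1), (fun p : E => star (p.1 i) * (reducedDM p.2 i k * p.1 k)) ∈ PgPG E := fun i k =>
    mul_mem (pgPG_star (pgPG_comp L1 (pgPG_coord i))) (mul_mem (pgPG_comp L2 (pgPG_DM i k)) (pgPG_comp L1 (pgPG_coord k)))
  have h2 : (fun p : E => star p.1 ⬝ᵥ reducedDM p.2 *ᵥ p.1) ∈ PgPG E := by
    have := sum_mem (S := PgPG E) (t := Finset.univ) (f := fun i : Fin (r + 1) => ∑ k : Fin (r + 1),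
      fun p : E => star (p.1 i) * (reducedDM p.2 i k * p.1 k)) (fun i _ => sum_mem fun k _ => h1 i k)
    convert this using 1
    funext p
    simp [dotProduct, mulVec, Finset.mul_sum]
  exact pgPG_int (pgMom_prod (pgG_mom _) (pgG_mom _)) (mul_mem (pow_mem h2 a) (pgPG_comp L2 (pgPG_rev j)))

lemma pg_H_int (r a j : ℕ) : Integrable (fun ψ : Fin (r + 1) × Fin n → ℂ =>
    pgH (fun i => ((pgDM_herm ψ).eigenvalues i : ℂ)) a * (reducedDM ψ).charpolyRev.coeff j)
    (pgG (Fin (r + 1) × Fin n)) := by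
  have := (pg_joint_int (n := n) r a j).integral_prod_right
  simp only [integral_mul_const, pg_gauss_herm (pgDM_herm _)] at this
  have h2 := this.const_mul ((a.factorial : ℂ)⁻¹)
  refine h2.congr (Filter.Eventually.of_forall fun ψ => ?_)
  have : (a.factorial : ℂ) ≠ 0 := by exact_mod_cast a.factorial_ne_zero
  simp only []
  field_simp

lemma pg_I (r a j : ℕ) [NeZero n] (hj : j ≤ n) :
    (a.factorial : ℂ) * ∫ ψ : Fin (r + 1) × Fin n → ℂ,
      pgH (fun i => ((pgDM_herm ψ).eigenvalues i : ℂ)) a * (reducedDM ψ).charpolyRev.coeff j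
      ∂(pgG (Fin (r + 1) × Fin n)) = ((r + 1).ascFactorial a : ℂ) * pgJ r n a j := by
  have h1 := integral_integral_swap (f := fun (z : Fin (r + 1) → ℂ) (ψ : Fin (r + 1) × Fin n → ℂ) =>
    (star z ⬝ᵥ reducedDM ψ *ᵥ z) ^ a * (reducedDM ψ).charpolyRev.coeff j) (pg_joint_int (n := n) r a j)
  simp only [pg_fix_z r a j hj, integral_mul_const, pg_gauss_herm (pgDM_herm _)] at h1
  rw [pgN_moment, Fintype.card_fin] at h1
  rw [h1, ← integral_const_mul]
  congr 1; funext ψ; ring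

lemma pg_I2 (r a j : ℕ) [NeZero n] (hj : j ≤ n) :
    ∫ ψ : Fin (r + 1) × Fin n → ℂ,
      pgH (fun i => ((pgDM_herm ψ).eigenvalues i : ℂ)) a * (reducedDM ψ).charpolyRev.coeff j
      ∂(pgG (Fin (r + 1) × Fin n)) = ((r + a).choose a : ℂ) * pgJ r n a j := by
  have h := pg_I r a j hj
  have h0 : (a.factorial : ℂ) ≠ 0 := by exact_mod_cast a.factorial_ne_zero
  apply mul_left_cancel₀ h0
  rw [h, Nat.ascFactorial_eq_factorial_mul_choose]
  push_cast
  ring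

lemma pg_trace_G (r k : ℕ) [NeZero n] (hk : k ≠ 0) (hr : r + 1 ≤ n) :
    ∫ ψ : Fin (r + 1) × Fin n → ℂ, ((reducedDM ψ) ^ k).trace ∂(pgG (Fin (r + 1) × Fin n)) =
      ∑ p ∈ Finset.HasAntidiagonal.antidiagonal k, if p.2 ≤ r + 1 then
        (p.1 : ℂ) * (((r + p.1).choose p.1 : ℂ) * pgJ r n p.1 p.2) else 0 := by
  have h : ∀ ψ : Fin (r + 1) × Fin n → ℂ, ((reducedDM ψ) ^ k).trace =
    ∑ p ∈ Finset.HasAntidiagonal.antidiagonal k, (p.1 : ℂ) *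
      (pgH (fun i => ((pgDM_herm ψ).eigenvalues i : ℂ)) p.1 * (reducedDM ψ).charpolyRev.coeff p.2) := by
    intro ψ
    rw [pg_trace_pow (pgDM_herm ψ), pg_newton _ _ hk]
    refine Finset.sum_congr rfl fun p _ => ?_
    rw [pgE_rev, mul_assoc]
  simp only [h]
  rw [integral_finsetSum _ fun p _ => (pg_H_int r p.1 p.2).const_mul _]
  refine Finset.sum_congr rfl fun p _ => ?_
  rw [integral_const_mul]
  split_ifs with hp
  · rw [pg_I2 _ _ _ (hp.trans hr)]
  · have : ∀ ψ : Fin (r + 1) × Fin n → ℂ, (reducedDM ψ).charpolyRev.coeff p.2 = 0 := fun ψ =>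
      pg_rev_coeff_zero _ (by simpa using hp)
    simp [this]

lemma pg_trace_mu (r k : ℕ) [NeZero n] (hk : k ≠ 0) (hr : r + 1 ≤ n)
    {μ : Measure (Fin (r + 1) × Fin n → ℂ)} [IsProbabilityMeasure μ] (hμ : PgInv μ)
    (hs : ∀ᵐ ψ ∂μ, pgN ψ = 1) :
    (((r + 1) * n).ascFactorial k : ℂ) * ∫ ψ, ((reducedDM ψ) ^ k).trace ∂μ =
      ∑ p ∈ Finset.HasAntidiagonal.antidiagonal k, if p.2 ≤ r + 1 then
        (p.1 : ℂ) * (((r + p.1).choose p.1 : ℂ) * pgJ r n p.1 p.2) else 0 := by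
  rw [← pg_trace_G r k hk hr]
  have hc : Continuous fun ψ : Fin (r + 1) × Fin n → ℂ => reducedDM ψ :=
    continuous_matrix fun i j => pgPG_cont (pgPG_DM i j)
  have hc2 : Continuous fun ψ : Fin (r + 1) × Fin n → ℂ => (reducedDM ψ ^ k).trace := (hc.pow k).matrix_trace
  rw [pg_homog pgG_inv hμ hs hc2 k]
  · rw [pgN_moment, Fintype.card_prod, Fintype.card_fin, Fintype.card_fin]
  · intro c x
    have : reducedDM (c • x) = ((c : ℂ) ^ 2) • reducedDM x := by
      ext i j
      simp only [reducedDM, Matrix.smul_apply, Finset.mul_sum, Pi.smul_apply, Complex.real_smul, map_mul,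
        Complex.conj_ofReal, smul_eq_mul]
      refine Finset.sum_congr rfl fun l _ => ?_
      ring
    rw [this, smul_pow, trace_smul, smul_eq_mul, ← pow_mul]

end PageMoments


section PageDiff
open Filter Topology

/-- iterated backward-type difference -/
def pgD : ℕ → (ℕ → ℝ) → ℕ → ℝ
  | 0, f => f
  | k + 1, f => fun n => pgD k f n - pgD k f (n + 1)

lemma pgD_add (k : ℕ) (f g : ℕ → ℝ) (n : ℕ) : pgD k (fun i => f i + g i) n = pgD k f n + pgD k g n := by
  induction k generalizing n with
  | zero => rfl
  | succ k ih => simp only [pgD, ih]; ring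

lemma pgD_smul (k : ℕ) (c : ℝ) (f : ℕ → ℝ) (n : ℕ) : pgD k (fun i => c * f i) n = c * pgD k f n := by
  induction k generalizing n with
  | zero => rfl
  | succ k ih => simp only [pgD, ih]; ring

lemma pgD_const (k : ℕ) (c : ℝ) (n : ℕ) : pgD (k + 1) (fun _ => c) n = 0 := by
  induction k generalizing n with
  | zero => simp [pgD]
  | succ k ih =>
    show pgD (k + 1) (fun _ => c) n - pgD (k + 1) (fun _ => c) (n + 1) = 0
    rw [ih, ih, sub_zero]

lemma pgD_congr (k : ℕ) (f g : ℕ → ℝ) (h : ∀ i, 1 ≤ i → f i = g i) (n : ℕ) (hn : 1 ≤ n) :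
    pgD k f n = pgD k g n := by
  induction k generalizing n with
  | zero => exact h n hn
  | succ k ih => simp only [pgD]; rw [ih n hn, ih (n + 1) (by omega)]

lemma pgD_inv (k : ℕ) (j : ℕ) (n : ℕ) (hn : 1 ≤ n) :
    pgD k (fun i => ((i : ℝ) + j)⁻¹) n = (k.factorial : ℝ) / ((n + j).ascFactorial (k + 1) : ℝ) := by
  induction k generalizing n with
  | zero => simp [pgD, Nat.ascFactorial]
  | succ k ih =>
    simp only [pgD]
    rw [ih n hn, ih (n + 1) (by omega)]
    have h1 : ((n + j).ascFactorial (k + 2) : ℝ) = (n + j + k + 1) * (n + j).ascFactorial (k + 1) := by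
      rw [Nat.ascFactorial_succ]; push_cast; ring
    have h2 : ((n + j).ascFactorial (k + 2) : ℝ) = (n + j) * (n + 1 + j).ascFactorial (k + 1) := by
      have := Nat.ascFactorial_mul_ascFactorial (n + j) 1 (k + 1)
      rw [show 1 + (k + 1) = k + 2 by ring] at this
      rw [← this, show n + 1 + j = n + j + 1 by ring]
      simp [Nat.ascFactorial]
    have p0 : (0 : ℝ) < (n + j : ℝ) := by
      have : (1 : ℝ) ≤ n := by exact_mod_cast hn
      positivity
    have p1 : (0 : ℝ) < ((n + j).ascFactorial (k + 2) : ℝ) := by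
      have : 0 < (n + j).ascFactorial (k + 2) := by
        obtain ⟨d, hd⟩ : ∃ d, n + j = d + 1 := ⟨n + j - 1, by omega⟩
        rw [hd]; exact Nat.ascFactorial_pos d (k+2)
      exact_mod_cast this
    have e1 : ((n + j).ascFactorial (k + 1) : ℝ) = (n + j).ascFactorial (k + 2) / (n + j + k + 1) := by
      rw [h1]; field_simp
    have e2 : ((n + 1 + j).ascFactorial (k + 1) : ℝ) = (n + j).ascFactorial (k + 2) / (n + j) := by
      rw [h2]; field_simp
    rw [e1, e2, Nat.factorial_succ]
    push_cast
    field_simp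
    ring

def PgOK (f : ℝ → ℝ) (d : ℝ) : Prop := HasDerivAt f d 1 ∧
  Tendsto (fun N : ℕ => ∑ k ∈ Finset.range N, pgD (k + 1) (fun n => f n) 1 / (k + 1)) atTop (𝓝 (-d))

lemma PgOK.add {f g : ℝ → ℝ} {d e : ℝ} (hf : PgOK f d) (hg : PgOK g e) : PgOK (fun q => f q + g q) (d + e) := by
  refine ⟨hf.1.add hg.1, ?_⟩
  have := hf.2.add hg.2
  rw [neg_add]
  refine this.congr fun N => ?_
  rw [← Finset.sum_add_distrib]
  refine Finset.sum_congr rfl fun k _ => ?_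
  rw [← add_div, ← pgD_add]

lemma PgOK.smul {f : ℝ → ℝ} {d : ℝ} (hf : PgOK f d) (c : ℝ) : PgOK (fun q => c * f q) (c * d) := by
  refine ⟨hf.1.const_mul c, ?_⟩
  have := hf.2.const_mul c
  rw [← mul_neg]
  refine this.congr fun N => ?_
  rw [Finset.mul_sum]
  refine Finset.sum_congr rfl fun k _ => ?_
  rw [← mul_div_assoc, ← pgD_smul]

lemma PgOK.congr {f g : ℝ → ℝ} {d : ℝ} (hf : PgOK f d) (h : ∀ q > 0, g q = f q) : PgOK g d := by
  refine ⟨hf.1.congr_of_eventuallyEq ?_, ?_⟩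
  · filter_upwards [lt_mem_nhds (show (0 : ℝ) < 1 by norm_num)] with q hq using h q hq
  · refine hf.2.congr fun N => Finset.sum_congr rfl fun k _ => ?_
    rw [pgD_congr (k + 1) (fun n => f n) (fun n => g n) (fun i hi => (h i (by exact_mod_cast hi)).symm) 1 le_rfl]

lemma PgOK_const (c : ℝ) : PgOK (fun _ => c) 0 := by
  refine ⟨hasDerivAt_const _ _, ?_⟩
  simp [pgD_const]

lemma PgOK.sum {ι : Type*} (s : Finset ι) (f : ι → ℝ → ℝ) (d : ι → ℝ) (h : ∀ i ∈ s, PgOK (f i) (d i)) :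
    PgOK (fun q => ∑ i ∈ s, f i q) (∑ i ∈ s, d i) := by
  classical
  induction s using Finset.induction_on with
  | empty => simpa using PgOK_const 0
  | insert a s ha ih =>
    simp only [Finset.sum_insert ha]
    exact (h a (Finset.mem_insert_self a s)).add (ih fun i hi => h i (Finset.mem_insert_of_mem hi))

lemma PgOK_inv (j : ℕ) : PgOK (fun q => (q + j)⁻¹) (-(1 / (1 + j : ℝ) ^ 2)) := by
  have hp : (0 : ℝ) < 1 + j := by positivity
  constructor
  · have := ((hasDerivAt_id (1 : ℝ)).add_const (j : ℝ)).inv hp.ne'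
    have e : -(1 / (1 + j : ℝ) ^ 2) = -1 / (id 1 + (j : ℝ)) ^ 2 := by simp [neg_div]
    rw [e]; exact this
  · rw [neg_neg]
    let u : ℕ → ℝ := fun N => (N.factorial : ℝ) / ((1 + j).ascFactorial (N + 1) : ℝ)
    have hpos : ∀ N, (0 : ℝ) < ((1 + j).ascFactorial N : ℝ) := fun N => by
      rw [add_comm]; exact_mod_cast Nat.ascFactorial_pos j N
    have hu : ∀ N, ∑ k ∈ Finset.range N, pgD (k + 1) (fun n : ℕ => ((n : ℝ) + j)⁻¹) 1 / (k + 1) =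
        (1 / (1 + j) - u N) / (1 + j) := by
      intro N
      induction N with
      | zero => simp [u, Nat.ascFactorial]
      | succ N ih =>
        rw [Finset.sum_range_succ, ih, pgD_inv _ _ _ le_rfl]
        have e : ((1 + j).ascFactorial (N + 1 + 1) : ℝ) = (1 + j + (N + 1)) * (1 + j).ascFactorial (N + 1) := by
          rw [Nat.ascFactorial_succ]; push_cast; ring
        have := hpos (N + 1)
        simp only [u, e, Nat.factorial_succ]
        push_cast
        field_simp
        ring
    have hu0 : Tendsto u atTop (𝓝 0) := by
      refine squeeze_zero (fun N => (div_pos (by exact_mod_cast N.factorial_pos) (hpos _)).le) (fun N => ?_)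
        (tendsto_one_div_add_atTop_nhds_zero_nat (𝕜 := ℝ))
      have h1 : ((N + 1).factorial : ℝ) ≤ (1 + j).ascFactorial (N + 1) := by
        have : (1 : ℕ).ascFactorial (N + 1) ≤ (1 + j).ascFactorial (N + 1) :=
          by
          rw [Nat.ascFactorial_eq_prod_range, Nat.ascFactorial_eq_prod_range]
          exact Finset.prod_le_prod' fun i _ => by omega
        rw [Nat.one_ascFactorial] at this
        exact_mod_cast this
      rw [Nat.factorial_succ] at h1
      push_cast at h1
      have := hpos (N + 1)
      simp only [u]
      rw [div_le_div_iff₀ this (by positivity)]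
      linarith
    have := (hu0.const_sub (1 / (1 + (j : ℝ)))).div_const (1 + (j : ℝ))
    refine (this.congr fun N => (hu N).symm).trans_eq ?_
    congr 1
    field_simp
    ring

/-- simple partial fraction form -/
def PgPF (S : Finset ℕ) (f : ℝ → ℝ) : Prop :=
  ∃ (C : ℝ) (c : ℕ → ℝ), ∀ q > 0, f q = C + ∑ j ∈ S, c j * (q + j)⁻¹

lemma PgPF.ok {S : Finset ℕ} {f : ℝ → ℝ} (hf : PgPF S f) {d : ℝ} (hd : HasDerivAt f d 1) : PgOK f d := by
  obtain ⟨C, c, h⟩ := hf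
  have h1 := ((PgOK_const C).add (PgOK.sum S (fun j q => c j * (q + j)⁻¹) _
    fun j _ => (PgOK_inv j).smul (c j))).congr h
  rwa [h1.1.unique hd] at h1

lemma PgPF.step {S : Finset ℕ} {f : ℝ → ℝ} (hf : PgPF S f) {j : ℕ} (hj : j ∉ S) (a b : ℝ) :
    PgPF (insert j S) (fun q => f q * (a * q + b) / (q + j)) := by
  obtain ⟨C, c, h⟩ := hf
  refine ⟨C * a, fun i => if i = j then C * (b - a * j) + ∑ l ∈ S, c l * (b - a * j) / ((l : ℝ) - j)
    else c i * (b - a * i) / ((j : ℝ) - i), fun q hq => ?_⟩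
  beta_reduce
  have hsum : ∑ x ∈ S, (if x = j then C * (b - a * j) + ∑ l ∈ S, c l * (b - a * j) / ((l : ℝ) - j)
      else c x * (b - a * x) / ((j : ℝ) - x)) * (q + x)⁻¹ =
      ∑ i ∈ S, c i * (b - a * i) / ((j : ℝ) - i) * (q + i)⁻¹ :=
    Finset.sum_congr rfl (fun i hi => by rw [if_neg (fun e : i = j => hj (e ▸ hi))])
  rw [h q hq, Finset.sum_insert hj, if_pos rfl, hsum]
  have hq' : ∀ i : ℕ, q + i ≠ 0 := fun i => by positivity
  have hs : ∀ i ∈ S, c i * (q + i)⁻¹ * (a * q + b) / (q + j) =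
      c i * (b - a * j) / ((i : ℝ) - j) * (q + j)⁻¹ + c i * (b - a * i) / ((j : ℝ) - i) * (q + i)⁻¹ := by
    intro i hi
    have hne : (i : ℝ) - j ≠ 0 := sub_ne_zero.2 (by
      intro e; exact hj ((Nat.cast_injective e) ▸ hi))
    have hne' : (j : ℝ) - i = - ((i : ℝ) - j) := by ring
    rw [hne']
    have := hq' i
    have := hq' j
    field_simp
    ring
  rw [add_mul, add_div, Finset.sum_mul, Finset.sum_div, Finset.sum_congr rfl hs, Finset.sum_add_distrib,
    ← Finset.sum_mul]
  have hC : C * (a * q + b) / (q + j) = C * a + C * (b - a * j) * (q + j)⁻¹ := by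
    have := hq' j
    field_simp
    ring
  rw [hC]
  ring

lemma PgPF_prod (α : ℕ → ℝ) (s d : ℕ) : ∀ p, p ≤ d → PgPF (Finset.Ico s (s + d))
    (fun q => (∏ i ∈ Finset.range p, (q + α i)) / ∏ l ∈ Finset.range d, (q + ((s + l : ℕ) : ℝ))) := by
  induction d with
  | zero =>
    intro p hp
    obtain rfl : p = 0 := by omega
    exact ⟨1, fun _ => 0, fun q _ => by simp⟩
  | succ d ih =>
    intro p hp
    have hS : Finset.Ico s (s + (d + 1)) = insert (s + d) (Finset.Ico s (s + d)) := by
      ext x; simp; omega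
    have hn : s + d ∉ Finset.Ico s (s + d) := by simp
    rw [hS]
    rcases Nat.lt_or_ge p (d + 1) with h | h
    · obtain ⟨C, c, hc⟩ := (ih p (by omega)).step hn 0 1
      refine ⟨C, c, fun q hq => ?_⟩
      rw [← hc q hq]
      beta_reduce
      rw [Finset.prod_range_succ, div_mul_eq_div_div]
      simp
    · obtain rfl : p = d + 1 := by omega
      obtain ⟨C, c, hc⟩ := (ih d le_rfl).step hn 1 (α d)
      refine ⟨C, c, fun q hq => ?_⟩
      rw [← hc q hq]
      beta_reduce
      rw [Finset.prod_range_succ, Finset.prod_range_succ, div_mul_eq_div_div, one_mul, div_mul_eq_mul_div]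

end PageDiff


section PageEnt
open Filter Topology
open scoped ComplexOrder

lemma pg_log_series {x : ℝ} (h0 : 0 ≤ x) (h1 : x ≤ 1) :
    HasSum (fun k : ℕ => x * (1 - x) ^ (k + 1) / (k + 1)) (Real.negMulLog x) := by
  rcases h0.eq_or_lt with rfl | h
  · simp
  · have := (Real.hasSum_pow_div_log_of_abs_lt_one (x := 1 - x) (by rw [abs_lt]; constructor <;> linarith)).mul_left x
    rw [sub_sub_cancel] at this
    have e : Real.negMulLog x = x * -Real.log x := by rw [Real.negMulLog]; ring
    rw [e]
    simpa only [mul_div_assoc] using this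

lemma pg_log_partial {x : ℝ} (h0 : 0 ≤ x) (h1 : x ≤ 1) (N : ℕ) :
    ‖∑ k ∈ Finset.range N, x * (1 - x) ^ (k + 1) / (k + 1)‖ ≤ 1 := by
  have hnn : ∀ k : ℕ, 0 ≤ x * (1 - x) ^ (k + 1) / (k + 1) := fun k => by
    have : 0 ≤ 1 - x := by linarith
    positivity
  rw [Real.norm_of_nonneg (Finset.sum_nonneg fun k _ => hnn k)]
  refine (sum_le_hasSum _ (fun k _ => hnn k) (pg_log_series h0 h1)).trans ?_
  rcases h0.eq_or_lt with rfl | h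
  · simp
  · have h2 := Real.log_le_sub_one_of_pos (inv_pos.2 h)
    rw [Real.log_inv] at h2
    rw [Real.negMulLog]
    have h3 := mul_le_mul_of_nonneg_left h2 h.le
    have h4 : x * (x⁻¹ - 1) = 1 - x := by field_simp
    nlinarith

variable {m n : ℕ}

/-- spectral moments of the reduced state -/
noncomputable def pgS (a k : ℕ) (ψ : Fin m × Fin n → ℂ) : ℝ :=
  ∑ i, (pgDM_herm ψ).eigenvalues i ^ a * (1 - (pgDM_herm ψ).eigenvalues i) ^ k

lemma pgS_zero (a : ℕ) (ψ : Fin m × Fin n → ℂ) : pgS a 0 ψ = ((reducedDM ψ) ^ a).trace.re := by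
  rw [pg_trace_pow (pgDM_herm ψ), pgS, Complex.re_sum]
  refine Finset.sum_congr rfl fun i _ => ?_
  rw [← Complex.ofReal_pow, Complex.ofReal_re, pow_zero, mul_one]

lemma pgS_succ (a k : ℕ) (ψ : Fin m × Fin n → ℂ) : pgS a (k + 1) ψ = pgS a k ψ - pgS (a + 1) k ψ := by
  simp only [pgS]
  rw [← Finset.sum_sub_distrib]
  refine Finset.sum_congr rfl fun i _ => ?_
  ring

lemma pgS_cont (k : ℕ) : ∀ a, Continuous fun ψ : Fin m × Fin n → ℂ => pgS a k ψ := by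
  induction k with
  | zero =>
    intro a
    simp only [pgS_zero]
    have hc : Continuous fun ψ : Fin m × Fin n → ℂ => reducedDM ψ :=
      continuous_matrix fun i j => pgPG_cont (pgPG_DM i j)
    exact Complex.continuous_re.comp (hc.pow a).matrix_trace
  | succ k ih =>
    intro a
    simp only [pgS_succ]
    exact (ih a).sub (ih (a + 1))

lemma pgDM_trace (ψ : Fin m × Fin n → ℂ) : ∑ i, (pgDM_herm ψ).eigenvalues i = pgN ψ := by
  have h := pgS_zero 1 ψ
  simp only [pgS, pow_one, pow_zero, mul_one] at h
  rw [h, Matrix.trace, Complex.re_sum, pgN, Fintype.sum_prod_type]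
  refine Finset.sum_congr rfl fun i _ => ?_
  rw [Matrix.diag_apply, reducedDM, Complex.re_sum]
  refine Finset.sum_congr rfl fun l _ => ?_
  rw [Complex.mul_conj, Complex.ofReal_re]

lemma pgDM_nonneg (ψ : Fin m × Fin n → ℂ) (i) : 0 ≤ (pgDM_herm ψ).eigenvalues i :=
  (pgDM_posSemidef ψ).eigenvalues_nonneg i

lemma pgDM_le_one {ψ : Fin m × Fin n → ℂ} (h : pgN ψ = 1) (i) : (pgDM_herm ψ).eigenvalues i ≤ 1 := by
  rw [← h, ← pgDM_trace]
  exact Finset.single_le_sum (f := fun i => (pgDM_herm ψ).eigenvalues i) (fun i _ => pgDM_nonneg ψ i) (Finset.mem_univ i)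

variable {μ : Measure (Fin m × Fin n → ℂ)} [IsProbabilityMeasure μ]

lemma pgS_int (hs : ∀ᵐ ψ ∂μ, pgN ψ = 1) (a k : ℕ) : Integrable (fun ψ => pgS a k ψ) μ := by
  refine Integrable.of_bound (pgS_cont k a).aestronglyMeasurable (m : ℝ) ?_
  filter_upwards [hs] with ψ h
  refine (norm_sum_le _ _).trans ?_
  refine (Finset.sum_le_card_nsmul _ _ 1 fun i _ => ?_).trans (by simp)
  have h0 := pgDM_nonneg ψ i
  have h1 := pgDM_le_one h i
  rw [Real.norm_of_nonneg (mul_nonneg (pow_nonneg h0 _) (pow_nonneg (by linarith) _))]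
  exact mul_le_one₀ (pow_le_one₀ h0 h1) (pow_nonneg (by linarith) _) (pow_le_one₀ (by linarith) (by linarith))

lemma pgS_integral (hs : ∀ᵐ ψ ∂μ, pgN ψ = 1) (k : ℕ) : ∀ a, ∫ ψ, pgS a k ψ ∂μ =
    pgD k (fun a => ∫ ψ, pgS a 0 ψ ∂μ) a := by
  induction k with
  | zero => intro a; rfl
  | succ k ih =>
    intro a
    simp only [pgS_succ, pgD]
    rw [integral_sub (pgS_int hs _ _) (pgS_int hs _ _), ih, ih]

lemma pg_entropy_limit (hs : ∀ᵐ ψ ∂μ, pgN ψ = 1) :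
    Tendsto (fun N => ∑ k ∈ Finset.range N, pgD (k + 1) (fun a => ∫ ψ, pgS a 0 ψ ∂μ) 1 / (k + 1)) atTop
      (𝓝 (∫ ψ, vnEntropy (reducedDM ψ) ∂μ)) := by
  have h1 : ∀ N, ∑ k ∈ Finset.range N, pgD (k + 1) (fun a => ∫ ψ, pgS a 0 ψ ∂μ) 1 / (k + 1) =
      ∫ ψ, ∑ k ∈ Finset.range N, pgS 1 (k + 1) ψ / (k + 1) ∂μ := by
    intro N
    rw [integral_finsetSum _ fun k _ => (pgS_int hs _ _).div_const _]
    refine Finset.sum_congr rfl fun k _ => ?_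
    rw [integral_div, pgS_integral hs]
  have h2 : ∀ N (ψ : Fin m × Fin n → ℂ), ∑ k ∈ Finset.range N, pgS 1 (k + 1) ψ / (k + 1) =
      ∑ i, ∑ k ∈ Finset.range N, (pgDM_herm ψ).eigenvalues i * (1 - (pgDM_herm ψ).eigenvalues i) ^ (k + 1) / (k + 1) := by
    intro N ψ
    rw [Finset.sum_comm]
    refine Finset.sum_congr rfl fun k _ => ?_
    rw [pgS, Finset.sum_div]
    simp only [pow_one]
  simp only [h1]
  refine tendsto_integral_of_dominated_convergence (fun _ => (m : ℝ)) ?_ (integrable_const _) ?_ ?_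
  · intro N
    exact (continuous_finsetSum _ fun k _ => (pgS_cont (k + 1) 1).div_const _).aestronglyMeasurable
  · intro N
    filter_upwards [hs] with ψ h
    rw [h2]
    refine (norm_sum_le _ _).trans ?_
    refine (Finset.sum_le_card_nsmul _ _ 1 fun i _ => ?_).trans (by simp)
    exact pg_log_partial (pgDM_nonneg ψ i) (pgDM_le_one h i) N
  · filter_upwards [hs] with ψ h
    simp only [h2]
    rw [vnEntropy, dif_pos (pgDM_herm ψ)]
    exact tendsto_finsetSum _ fun i _ => (pg_log_series (pgDM_nonneg ψ i) (pgDM_le_one h i)).tendsto_sum_nat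

end PageEnt


section PageAlg
open Filter Topology

noncomputable def pgQ (s d : ℕ) (q : ℝ) : ℝ := ∏ l ∈ Finset.range d, (q + ((s + l : ℕ) : ℝ))
noncomputable def pgP (m b : ℕ) (q : ℝ) : ℝ := ∏ i ∈ Finset.range m, (q + ((i : ℝ) - b))

lemma pgQ_val (s d k : ℕ) : pgQ s d (k : ℝ) = ((k + s).ascFactorial d : ℝ) := by
  rw [pgQ, Nat.ascFactorial_eq_prod_range]
  push_cast
  exact Finset.prod_congr rfl fun i _ => by ring

lemma pgP_val (m : ℕ) {b k : ℕ} (h : b ≤ k) : pgP m b (k : ℝ) = ((k - b).ascFactorial m : ℝ) := by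
  rw [pgP, Nat.ascFactorial_eq_prod_range]
  push_cast [Nat.cast_sub h]
  exact Finset.prod_congr rfl fun i _ => by ring

lemma pgP_zero (m : ℕ) {b k : ℕ} (h : k < b) (hb : b < m + k) : pgP m b (k : ℝ) = 0 := by
  refine Finset.prod_eq_zero (i := b - k) (Finset.mem_range.2 (by omega)) ?_
  push_cast [Nat.cast_sub h.le]; ring

lemma pg_binom_asc (r a : ℕ) : (a : ℝ) * ((r + a).choose a : ℝ) = (a.ascFactorial (r + 1) : ℝ) / (r.factorial : ℝ) := by
  rw [eq_div_iff (by exact_mod_cast r.factorial_ne_zero)]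
  have : a * (r + a).choose a * r.factorial = a.ascFactorial (r + 1) := by
    have h := Nat.ascFactorial_mul_ascFactorial a 1 r
    rw [add_comm r 1, ← h, Nat.ascFactorial_eq_factorial_mul_choose a r, add_comm r a, Nat.choose_symm_add]
    simp [Nat.ascFactorial]
    ring
  exact_mod_cast this

lemma pg_asc_pos {n : ℕ} (hn : 0 < n) (k : ℕ) : (0 : ℝ) < (n.ascFactorial k : ℝ) := by
  obtain ⟨d, rfl⟩ : ∃ d, n = d + 1 := ⟨n - 1, by omega⟩
  exact_mod_cast Nat.ascFactorial_pos d k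

/-- ratio of rising factorials -/
lemma pg_asc_ratio {n : ℕ} (hn : 0 < n) (r k a d : ℕ) (h : a + d = r * n + k) :
    (n.ascFactorial a : ℝ) / (((r + 1) * n).ascFactorial k : ℝ) =
      (n.ascFactorial (r * n) : ℝ) / ((n + a).ascFactorial d : ℝ) := by
  have p1 := pg_asc_pos (n := (r + 1) * n) (by positivity) k
  have p2 := pg_asc_pos (n := n + a) (by omega) d
  rw [div_eq_div_iff p1.ne' p2.ne']
  have e1 := Nat.ascFactorial_mul_ascFactorial n a d
  have e2 := Nat.ascFactorial_mul_ascFactorial n (r * n) k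
  rw [h, ← e2] at e1
  rw [show (r + 1) * n = n + r * n by ring]
  exact_mod_cast e1

noncomputable def pgF0 (r n : ℕ) (q : ℝ) : ℝ :=
  ((n.ascFactorial (r * n) : ℝ) / (r.factorial : ℝ)) * (pgP (r + 1) 0 q / pgQ n (r * n) q)

noncomputable def pgFc (r n c : ℕ) (q : ℝ) : ℝ :=
  ((-1) ^ (c + 1) * (n.ascFactorial (r * n) : ℝ) / (r.factorial : ℝ)) *
    ((r.choose (c + 1) * n.descFactorial (c + 1) : ℝ) * (pgP (r + 1) (c + 1) q / pgQ (n - (c + 1)) (r * n + (c + 1)) q) +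
     (r.choose c * (n - 1).descFactorial c : ℝ) * (pgP (r + 1) (c + 1) q / pgQ (n - c) (r * n + c) q))

lemma pgJ_zero (r n a : ℕ) (hn : 0 < n) : pgJ r n a 0 = (n.ascFactorial a : ℂ) := by
  rw [pgJ, pgT_iter_coeff, pgT_iter_coeff, if_pos (by omega), if_neg (by omega)]
  simp

lemma pgJ_succ (r n a c : ℕ) (hc : c + 1 ≤ n) : pgJ r n a (c + 1) =
    (((-1) ^ (c + 1) * (n.ascFactorial a * (r.choose (c + 1) * n.descFactorial (c + 1)) +
      n.ascFactorial (a + 1) * (r.choose c * (n - 1).descFactorial c)) : ℝ) : ℂ) := by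
  rw [pgJ, pgT_iter_coeff, pgT_iter_coeff, if_pos (by omega), if_pos (by omega),
    show n - (n - (c + 1)) = c + 1 by omega, show n - 1 - (n - (c + 1)) = c by omega]
  push_cast
  ring

lemma pgF0_val (r n k : ℕ) (hn : 0 < n) : pgF0 r n k * (((r + 1) * n).ascFactorial k : ℝ) =
    (k : ℝ) * ((r + k).choose k : ℝ) * n.ascFactorial k := by
  have p1 := pg_asc_pos (n := (r + 1) * n) (by positivity) k
  have h := pg_asc_ratio hn r k k (r * n) (by ring)
  rw [pgF0, pgP_val _ (Nat.zero_le _), pgQ_val, pg_binom_asc, Nat.sub_zero, add_comm k n]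
  rw [div_eq_iff p1.ne'] at h
  rw [h]
  ring

lemma pgFc_val (r n k c : ℕ) (hc : c + 1 ≤ n) (hk : c + 1 ≤ k) :
    pgFc r n c k * (((r + 1) * n).ascFactorial k : ℝ) =
    ((k - (c + 1) : ℕ) : ℝ) * ((r + (k - (c + 1))).choose (k - (c + 1)) : ℝ) *
    ((-1) ^ (c + 1) * (n.ascFactorial (k - (c + 1)) * (r.choose (c + 1) * n.descFactorial (c + 1)) +
      n.ascFactorial (k - (c + 1) + 1) * (r.choose c * (n - 1).descFactorial c)) : ℝ) := by
  have hn : 0 < n := by omega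
  have p1 := pg_asc_pos (n := (r + 1) * n) (by positivity) k
  have h := pg_asc_ratio (show 0 < n by omega) r k (k - (c + 1)) (r * n + (c + 1)) (by omega)
  have h2 := pg_asc_ratio (show 0 < n by omega) r k (k - (c + 1) + 1) (r * n + c) (by omega)
  rw [pgFc, pgP_val _ hk, pgQ_val, pgQ_val, pg_binom_asc,
    show k + (n - (c + 1)) = n + (k - (c + 1)) by omega, show k + (n - c) = n + (k - (c + 1) + 1) by omega]
  rw [div_eq_iff p1.ne'] at h h2
  rw [h, h2]
  ring

lemma pgFc_val0 (r n k c : ℕ) (hc : c < r + 1) (hk : k < c + 1) (hk0 : k ≠ 0) : pgFc r n c k = 0 := by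
  rw [pgFc, pgP_zero _ hk (by omega)]
  simp

lemma pg_moment {r n : ℕ} (hr : r + 1 ≤ n) {k : ℕ} (hk : k ≠ 0)
    {μ : Measure (Fin (r + 1) × Fin n → ℂ)} [IsProbabilityMeasure μ] (hμ : PgInv μ)
    (hs : ∀ᵐ ψ ∂μ, pgN ψ = 1) :
    ∫ ψ, pgS k 0 ψ ∂μ = pgF0 r n k + ∑ c ∈ Finset.range (r + 1), pgFc r n c k := by
  have : NeZero n := ⟨by omega⟩
  have p1 := pg_asc_pos (n := (r + 1) * n) (Nat.mul_pos (by omega) (by omega)) k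
  have h := pg_trace_mu r k hk hr hμ hs
  have hre : ∫ ψ, ((reducedDM ψ) ^ k).trace ∂μ = ((∫ ψ, pgS k 0 ψ ∂μ : ℝ) : ℂ) := by
    rw [← integral_complex_ofReal]
    congr 1; funext ψ
    rw [pg_trace_pow (pgDM_herm ψ), pgS]
    push_cast
    simp
  rw [hre] at h
  apply mul_right_cancel₀ p1.ne'
  rw [mul_comm]
  apply Complex.ofReal_injective
  rw [Complex.ofReal_mul, Complex.ofReal_natCast, h]
  let g : ℕ → ℝ := fun b => match b with
    | 0 => pgF0 r n k * (((r + 1) * n).ascFactorial k : ℝ)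
    | c + 1 => pgFc r n c k * (((r + 1) * n).ascFactorial k : ℝ)
  have hg : (pgF0 r n k + ∑ c ∈ Finset.range (r + 1), pgFc r n c k) * (((r + 1) * n).ascFactorial k : ℝ) =
      ∑ b ∈ Finset.range (r + 1 + 1), g b := by
    rw [Finset.sum_range_succ' g, add_mul, Finset.sum_mul, add_comm]
  rw [hg]
  rw [← Finset.Nat.sum_antidiagonal_swap, Finset.Nat.sum_antidiagonal_eq_sum_range_succ_mk]
  have h1 : ∀ b ∈ Finset.range k.succ, (if ((b, k - b) : ℕ × ℕ).swap.2 ≤ r + 1 then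
      (((b, k - b) : ℕ × ℕ).swap.1 : ℂ) * (((r + ((b, k - b) : ℕ × ℕ).swap.1).choose ((b, k - b) : ℕ × ℕ).swap.1 : ℂ)
        * pgJ r n ((b, k - b) : ℕ × ℕ).swap.1 ((b, k - b) : ℕ × ℕ).swap.2) else 0) =
      if b ≤ r + 1 then (g b : ℂ) else 0 := by
    intro b hb
    rw [Finset.mem_range] at hb
    simp only [Prod.swap_prod_mk]
    split_ifs with hbr
    · cases b with
      | zero =>
        simp only [g]
        rw [pgF0_val _ _ _ (by omega), pgJ_zero _ _ _ (by omega)]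
        push_cast
        simp [mul_assoc]
      | succ c =>
        simp only [g]
        rw [pgFc_val _ _ _ _ (by omega) (by omega), pgJ_succ _ _ _ _ (by omega)]
        push_cast
        ring
    · rfl
  rw [Finset.sum_congr rfl h1, ← Finset.sum_filter, Complex.ofReal_sum]
  refine Finset.sum_subset (fun b hb => ?_) (fun b hb hb2 => ?_)
  · simp only [Finset.mem_filter, Finset.mem_range] at hb ⊢; omega
  · simp only [Finset.mem_filter, Finset.mem_range] at hb hb2
    cases b with
    | zero => omega
    | succ c => simp only [g]; rw [pgFc_val0 r n k c (by omega) (by omega) hk]; simp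

end PageAlg


section PageDer
open Filter Topology

lemma pg_prod_deriv (α : ℕ → ℝ) (p : ℕ) (h : ∀ i, 1 + α i ≠ 0) :
    HasDerivAt (fun q : ℝ => ∏ i ∈ Finset.range p, (q + α i))
      ((∏ i ∈ Finset.range p, (1 + α i)) * ∑ i ∈ Finset.range p, (1 + α i)⁻¹) 1 := by
  induction p with
  | zero => simpa using hasDerivAt_const (1 : ℝ) (1 : ℝ)
  | succ p ih =>
    have h2 := ih.mul ((hasDerivAt_id (1 : ℝ)).add_const (α p))
    simp only [Finset.prod_range_succ, Finset.sum_range_succ]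
    refine h2.congr_deriv ?_
    have := h p
    simp only [id]
    field_simp

lemma pgQ_pos (s d : ℕ) : 0 < pgQ s d 1 := Finset.prod_pos fun i _ => by positivity

lemma pgQ_deriv (s d : ℕ) : HasDerivAt (pgQ s d)
    (pgQ s d 1 * ∑ l ∈ Finset.range d, (1 + ((s + l : ℕ) : ℝ))⁻¹) 1 :=
  pg_prod_deriv (fun l => ((s + l : ℕ) : ℝ)) d fun i => by positivity

lemma pgP_diff (m b : ℕ) (q : ℝ) : DifferentiableAt ℝ (pgP m b) q := by
  unfold pgP; fun_prop

lemma pg_KQ {n : ℕ} (hn : 0 < n) (r : ℕ) : (n.ascFactorial (r * n) : ℝ) * (r + 1) = ((n + 1).ascFactorial (r * n) : ℝ) := by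
  have h1 := Nat.ascFactorial_mul_ascFactorial n 1 (r * n)
  have h2 := Nat.ascFactorial_mul_ascFactorial n (r * n) 1
  rw [add_comm 1, ← h2] at h1
  simp only [Nat.ascFactorial_succ, Nat.ascFactorial_zero, add_zero, mul_one] at h1
  have h3 : ((n : ℝ)) * ((n + 1).ascFactorial (r * n) : ℝ) = (n.ascFactorial (r * n) : ℝ) * (n + r * n) := by
    exact_mod_cast h1
  have : (n : ℝ) ≠ 0 := by positivity
  apply mul_left_cancel₀ this
  rw [h3]; ring

lemma pgF0_ok {r n : ℕ} (hr : 1 ≤ r) (hn : r + 1 ≤ n) : PgOK (pgF0 r n)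
    (∑ i ∈ Finset.range (r + 1), ((i : ℝ) + 1)⁻¹ - ∑ l ∈ Finset.range (r * n), ((n : ℝ) + 1 + l)⁻¹) := by
  have hpf := PgPF_prod (fun i => (i : ℝ) - (0 : ℕ)) n (r * n) (r + 1) (by nlinarith)
  have hP := pg_prod_deriv (fun i => (i : ℝ) - (0 : ℕ)) (r + 1) (fun i => by
    push_cast; rw [sub_zero]; positivity)
  have hQ := pgQ_deriv n (r * n)
  have hd := hP.div hQ (pgQ_pos n (r * n)).ne'
  have hok := ((hpf.ok hd).smul ((n.ascFactorial (r * n) : ℝ) / (r.factorial : ℝ)))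
  have hval : pgQ n (r * n) 1 = ((n + 1).ascFactorial (r * n) : ℝ) := by
    have := pgQ_val n (r * n) 1
    rw [add_comm 1 n] at this
    exact_mod_cast this
  have hPv : ∏ i ∈ Finset.range (r + 1), (1 + ((i : ℝ) - (0 : ℕ))) = ((r + 1).factorial : ℝ) := by
    rw [← Finset.prod_range_add_one_eq_factorial]
    push_cast
    exact Finset.prod_congr rfl fun i _ => by ring
  have hS1 : ∑ i ∈ Finset.range (r + 1), (1 + ((i : ℝ) - (0 : ℕ)))⁻¹ = ∑ i ∈ Finset.range (r + 1), ((i : ℝ) + 1)⁻¹ :=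
    Finset.sum_congr rfl fun i _ => by congr 1; push_cast; ring
  have hS2 : ∑ l ∈ Finset.range (r * n), (1 + ((n + l : ℕ) : ℝ))⁻¹ = ∑ l ∈ Finset.range (r * n), ((n : ℝ) + 1 + l)⁻¹ :=
    Finset.sum_congr rfl fun i _ => by congr 1; push_cast; ring
  have hK := pg_KQ (show 0 < n by omega) r
  have hp := pg_asc_pos (show 0 < n by omega) (r * n)
  rw [hPv, hS1, hS2, hval, ← hK, Nat.factorial_succ] at hok
  have hf : (r.factorial : ℝ) ≠ 0 := by exact_mod_cast r.factorial_ne_zero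
  have hm : (r : ℝ) + 1 ≠ 0 := by positivity
  refine Eq.subst (motive := fun d => PgOK (pgF0 r n) d) ?_ hok
  push_cast
  field_simp

lemma pgP_factor (c e : ℕ) (q : ℝ) : pgP (c + e + 1) (c + 1) q =
    (q - 1) * ((∏ i ∈ Finset.range c, (q + ((i : ℝ) - (c + 1)))) * ∏ i ∈ Finset.range e, (q + i)) := by
  rw [pgP, show c + e + 1 = c + 1 + e by ring, Finset.prod_range_add, Finset.prod_range_succ]
  have : ∏ x ∈ Finset.range e, (q + (((c + 1 + x : ℕ) : ℝ) - ((c + 1 : ℕ) : ℝ))) = ∏ i ∈ Finset.range e, (q + i) :=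
    Finset.prod_congr rfl fun i _ => by push_cast; ring
  rw [this]
  push_cast
  ring

lemma pg_sign_prod (c : ℕ) : ∏ i ∈ Finset.range c, ((1 : ℝ) + ((i : ℝ) - (c + 1))) = (-1) ^ c * (c.factorial : ℝ) := by
  have h1 : ∏ i ∈ Finset.range c, ((1 : ℝ) + ((i : ℝ) - (c + 1))) = ∏ i ∈ Finset.range c, (-1 * ((c - i : ℕ) : ℝ)) :=
    Finset.prod_congr rfl fun i hi => by
      rw [Nat.cast_sub (Finset.mem_range.1 hi).le]; ring
  rw [h1, Finset.prod_mul_distrib, Finset.prod_const, Finset.card_range, ← Nat.cast_prod]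
  congr 2
  have := Nat.descFactorial_eq_prod_range c c
  rw [← this, Nat.descFactorial_self]

lemma pgP_div_deriv (c e s d : ℕ) : HasDerivAt (fun q => pgP (c + e + 1) (c + 1) q / pgQ s d q)
    ((-1) ^ c * (c.factorial : ℝ) * (e.factorial : ℝ) / ((s + 1).ascFactorial d : ℝ)) 1 := by
  let h : ℝ → ℝ := fun q => ((∏ i ∈ Finset.range c, (q + ((i : ℝ) - (c + 1)))) * ∏ i ∈ Finset.range e, (q + i)) / pgQ s d q
  have hh : DifferentiableAt ℝ h 1 := by
    refine DifferentiableAt.div ?_ (pgQ_deriv s d).differentiableAt (pgQ_pos s d).ne'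
    fun_prop
  have h1 := ((hasDerivAt_id (1 : ℝ)).sub_const 1).mul hh.hasDerivAt
  have hv : h 1 = (-1) ^ c * (c.factorial : ℝ) * (e.factorial : ℝ) / ((s + 1).ascFactorial d : ℝ) := by
    have e1 : pgQ s d 1 = ((s + 1).ascFactorial d : ℝ) := by
      have := pgQ_val s d 1
      rw [add_comm 1 s] at this
      exact_mod_cast this
    have e2 : ∏ i ∈ Finset.range e, ((1 : ℝ) + i) = (e.factorial : ℝ) := by
      rw [← Finset.prod_range_add_one_eq_factorial]
      push_cast
      exact Finset.prod_congr rfl fun i _ => by ring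
    simp only [h]
    rw [pg_sign_prod, e1, e2]
  have h2 : (fun q => pgP (c + e + 1) (c + 1) q / pgQ s d q) = (fun q => (q - 1) * h q) := by
    funext q
    rw [pgP_factor]
    simp only [h]
    rw [mul_div_assoc]
  rw [h2, ← hv]
  refine h1.congr_deriv ?_
  simp

lemma pgFc_ok {c e n : ℕ} (hr : 1 ≤ c + e) (hn : c + e + 1 ≤ n) : PgOK (pgFc (c + e) n c)
    (-(1 / ((c : ℝ) + e + 1)) * ((e : ℝ) / (c + 1) + ((n : ℝ) - c) / n)) := by
  have hrn : c + e + 1 ≤ (c + e) * n := by nlinarith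
  have k1 := (PgPF_prod (fun i => (i : ℝ) - ((c + 1 : ℕ) : ℝ)) (n - (c + 1)) ((c + e) * n + (c + 1)) (c + e + 1)
    (by omega)).ok (pgP_div_deriv c e (n - (c + 1)) ((c + e) * n + (c + 1)))
  have k2 := (PgPF_prod (fun i => (i : ℝ) - ((c + 1 : ℕ) : ℝ)) (n - c) ((c + e) * n + c) (c + e + 1)
    (by omega)).ok (pgP_div_deriv c e (n - c) ((c + e) * n + c))
  have hok := ((k1.smul (((c + e).choose (c + 1) * n.descFactorial (c + 1) : ℝ))).add
    (k2.smul (((c + e).choose c * (n - 1).descFactorial c : ℝ)))).smul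
      ((-1) ^ (c + 1) * (n.ascFactorial ((c + e) * n) : ℝ) / ((c + e).factorial : ℝ))
  refine Eq.subst (motive := fun d => PgOK (pgFc (c + e) n c) d) ?_ hok
  obtain ⟨u, rfl⟩ : ∃ u, n = c + 1 + u := ⟨n - (c + 1), by omega⟩
  set n := c + 1 + u with hndef
  have hK := pg_KQ (show 0 < n by omega) (c + e)
  have hp := pg_asc_pos (show 0 < n by omega) ((c + e) * n)
  have d1 : n.descFactorial (c + 1) = (u + 1).ascFactorial (c + 1) := by
    rw [hndef, add_comm (c + 1) u, Nat.add_descFactorial_eq_ascFactorial]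
  have a1 : (n - (c + 1) + 1).ascFactorial ((c + e) * n + (c + 1)) =
      (u + 1).ascFactorial (c + 1) * (n + 1).ascFactorial ((c + e) * n) := by
    rw [show n - (c + 1) + 1 = u + 1 by omega, add_comm ((c + e) * n), ← Nat.ascFactorial_mul_ascFactorial,
      show u + 1 + (c + 1) = n + 1 by omega]
  have a2 : (n - c + 1).ascFactorial ((c + e) * n + c) =
      (u + 2).ascFactorial c * (n + 1).ascFactorial ((c + e) * n) := by
    rw [show n - c + 1 = u + 2 by omega, add_comm ((c + e) * n), ← Nat.ascFactorial_mul_ascFactorial,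
      show u + 2 + c = n + 1 by omega]
  have d2 : (n - 1).descFactorial c = (u + 1).ascFactorial c := by
    rw [show n - 1 = u + c by omega, Nat.add_descFactorial_eq_ascFactorial]
  have d3 : ((u + 1).ascFactorial c : ℝ) * n = (u + 1) * ((u + 2).ascFactorial c : ℝ) := by
    have h1 := Nat.ascFactorial_mul_ascFactorial (u + 1) 1 c
    have h2 := Nat.ascFactorial_mul_ascFactorial (u + 1) c 1
    rw [add_comm 1, ← h2] at h1
    simp only [Nat.ascFactorial_succ, Nat.ascFactorial_zero, add_zero, mul_one] at h1
    rw [show u + 1 + c = n by omega] at h1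
    exact_mod_cast h1.symm
  have c1 : ((c + e).choose c : ℝ) * ((c.factorial : ℝ) * (e.factorial : ℝ)) = ((c + e).factorial : ℝ) := by
    have := Nat.add_choose_mul_factorial_mul_factorial c e
    rw [mul_assoc, ← Nat.choose_symm_add] at this
    exact_mod_cast this
  have c2 : ((c + e).choose (c + 1) : ℝ) * (c + 1) = ((c + e).choose c : ℝ) * e := by
    have := Nat.choose_succ_right_eq (c + e) c
    rw [Nat.add_sub_cancel_left] at this
    exact_mod_cast this
  have hnR : (n : ℝ) - c = u + 1 := by rw [hndef]; push_cast; ring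
  rw [a1, a2, d1, d2, hnR]
  have q1 := pg_asc_pos (show 0 < u + 1 by omega) (c + 1)
  have q2 := pg_asc_pos (show 0 < u + 2 by omega) c
  have q3 : (0 : ℝ) < n := by rw [hndef]; positivity
  have q4 : (0 : ℝ) < ((c + e).factorial : ℝ) := by exact_mod_cast (c + e).factorial_pos
  have d3' : ((u + 1).ascFactorial c : ℝ) = (u + 1) * ((u + 2).ascFactorial c : ℝ) / n := by
    rw [eq_div_iff q3.ne', d3]
  have c2' : ((c + e).choose (c + 1) : ℝ) = ((c + e).choose c : ℝ) * e / (c + 1) := by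
    rw [eq_div_iff (by positivity), c2]
  have sg : ((-1 : ℝ) ^ (c + 1)) * (-1) ^ c = -1 := by
    rw [← pow_add, show c + 1 + c = 2 * c + 1 by ring, pow_succ, pow_mul]; norm_num
  push_cast at hK
  push_cast
  rw [← hK, d3', c2']
  have q5 : ((c : ℝ) + e + 1) ≠ 0 := by positivity
  have q6 : ((c : ℝ) + 1) ≠ 0 := by positivity
  rw [← c1] at q4 ⊢
  have q7 : ((c + e).choose c : ℝ) ≠ 0 := left_ne_zero_of_mul q4.ne'
  have q8 := right_ne_zero_of_mul q4.ne'
  have q9 := left_ne_zero_of_mul q8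
  have q10 := right_ne_zero_of_mul q8
  generalize ((c + e).choose c : ℝ) = B at *
  generalize ((u + 1).ascFactorial (c + 1) : ℝ) = A1 at *
  generalize ((u + 2).ascFactorial c : ℝ) = A2 at *
  generalize (n.ascFactorial ((c + e) * n) : ℝ) = K at *
  generalize (c.factorial : ℝ) = Fc at *
  generalize (e.factorial : ℝ) = Fe at *
  have q1' := q1.ne'
  have q2' := q2.ne'
  have q3' := q3.ne'
  have hp' := hp.ne'
  trans ((-1 : ℝ) ^ (c + 1) * (-1) ^ c) * (1 / ((c : ℝ) + e + 1) * ((e : ℝ) / (c + 1) + ((u : ℝ) + 1) / n))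
  · generalize (-1 : ℝ) ^ (c + 1) = S1
    generalize (-1 : ℝ) ^ c = S2
    field_simp
  · rw [sg]; ring

lemma pg_total {r n : ℕ} (hr : 1 ≤ r) (hn : r + 1 ≤ n) :
    PgOK (fun q => pgF0 r n q + ∑ c ∈ Finset.range (r + 1), pgFc r n c q)
      (-((∑ k ∈ Finset.Icc (n + 1) ((r + 1) * n), (1 : ℝ) / k) - (((r + 1 : ℕ) : ℝ) - 1) / (2 * n))) := by
  have h1 := pgF0_ok hr hn
  have h2 := PgOK.sum (Finset.range (r + 1)) (fun c => pgFc r n c)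
    (fun c => -(1 / ((r : ℝ) + 1)) * (((r : ℝ) - c) / (c + 1) + ((n : ℝ) - c) / n)) (fun c hc => by
      rw [Finset.mem_range] at hc
      obtain ⟨e, rfl⟩ : ∃ e, r = c + e := ⟨r - c, by omega⟩
      have := pgFc_ok hr hn
      push_cast
      rwa [add_sub_cancel_left])
  have h3 := h1.add h2
  refine Eq.subst (motive := fun d => PgOK _ d) ?_ h3
  have hm : (r : ℝ) + 1 ≠ 0 := by positivity
  have hn0 : (n : ℝ) ≠ 0 := by
    have : 0 < n := by omega
    positivity
  have hS : ∑ k ∈ Finset.Icc (n + 1) ((r + 1) * n), (1 : ℝ) / k = ∑ l ∈ Finset.range (r * n), ((n : ℝ) + 1 + l)⁻¹ := by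
    rw [← Finset.Ico_succ_right_eq_Icc, Finset.sum_Ico_eq_sum_range]
    have : Order.succ ((r + 1) * n) - (n + 1) = r * n := by
      rw [Nat.succ_eq_succ, Nat.succ_eq_add_one, add_mul, one_mul]; omega
    rw [this]
    refine Finset.sum_congr rfl fun l _ => ?_
    push_cast
    rw [one_div]
  have hterm : ∀ c : ℕ, -(1 / ((r : ℝ) + 1)) * (((r : ℝ) - c) / (c + 1) + ((n : ℝ) - c) / n) =
      -((c : ℝ) + 1)⁻¹ + (1 / (((r : ℝ) + 1) * n)) * c := by
    intro c
    have : (c : ℝ) + 1 ≠ 0 := by positivity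
    field_simp
    ring
  have hid : (∑ c ∈ Finset.range (r + 1), (c : ℝ)) = ((r : ℝ) + 1) * r / 2 := by
    have := Finset.sum_range_id_mul_two (r + 1)
    rw [eq_div_iff two_ne_zero]
    rw [Nat.add_sub_cancel] at this
    have h := congrArg (fun x : ℕ => (x : ℝ)) this
    push_cast at h
    exact h
  rw [Finset.sum_congr rfl fun c _ => hterm c, Finset.sum_add_distrib, ← Finset.mul_sum, hid, hS,
    Finset.sum_neg_distrib]
  push_cast
  field_simp
  ring

end PageDer


theorem page_average_entanglement_entropy (dA dB : ℕ) (hdA : 0 < dA) (hle : dA ≤ dB)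
    (μ : Measure (Fin dA × Fin dB → ℂ)) [IsProbabilityMeasure μ]
    (hsphere : ∀ᵐ ψ ∂μ, ∑ i, Complex.normSq (ψ i) = 1)
    (hinv : ∀ U ∈ Matrix.unitaryGroup (Fin dA × Fin dB) ℂ,
      μ.map (fun ψ => U.mulVec ψ) = μ) :
    ∫ ψ, vnEntropy (reducedDM ψ) ∂μ =
      (∑ k ∈ Finset.Icc (dB + 1) (dA * dB), (1 : ℝ) / k) - ((dA : ℝ) - 1) / (2 * dB) := by
  obtain ⟨r, rfl⟩ : ∃ r, dA = r + 1 := ⟨dA - 1, by omega⟩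
  have hs : ∀ᵐ ψ ∂μ, pgN ψ = 1 := hsphere
  have hμ : PgInv μ := hinv
  rcases Nat.eq_zero_or_pos r with rfl | hr
  · have h0 : ∀ᵐ ψ ∂μ, vnEntropy (reducedDM ψ) = 0 := by
      filter_upwards [hs] with ψ h
      rw [← pgDM_trace] at h
      rw [vnEntropy, dif_pos (pgDM_herm ψ)]
      rw [Fin.sum_univ_succ, Fin.sum_univ_zero, add_zero] at h ⊢
      rw [h, Real.negMulLog_one]
    rw [integral_congr_ae h0]
    simp
  · have hlim := pg_entropy_limit hs
    have hok := (pg_total hr hle).2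
    rw [neg_neg] at hok
    refine tendsto_nhds_unique hlim (hok.congr fun N => Finset.sum_congr rfl fun k _ => ?_)
    congr 1
    refine pgD_congr _ _ _ (fun i hi => ?_) 1 le_rfl
    exact (pg_moment hle (by omega) hμ hs).symm
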